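/- Let μ be a nonzero uniformly distributed measure on (ℍ^n, d_H). Then supp(μ) is a real analytic variety in ℝ^{2n+1}: there is a family (F_s)_{s>0} of real analytic functions F_s : ℝ^{2n+1} → ℝ with supp(μ) = ⋂_{s>0} F_s⁻¹(0). Moreover, the Hausdorff dimension of supp(μ) with respect to the metric d_H is an integer. -/

import Mathlib

open MeasureTheory Set Filter ENNReal NNReal

noncomputable section

/-- The underlying space of the Heisenberg group `ℍⁿ = ℝ²ⁿ × ℝ`. -/
abbrev Heis (n : ℕ) := EuclideanSpace ℝ (Fin (2 * n)) × ℝ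

/-- The symplectic form `A(x',y') = -2 ∑ (x_j y_{j+n} - x_{j+n} y_j)` on `ℝ²ⁿ`. -/
def symp {n : ℕ} (x y : EuclideanSpace ℝ (Fin (2 * n))) : ℝ :=
  -2 * ∑ j : Fin n,
    (x ⟨j.1, by have := j.isLt; omega⟩ * y ⟨j.1 + n, by have := j.isLt; omega⟩ -
     x ⟨j.1 + n, by have := j.isLt; omega⟩ * y ⟨j.1, by have := j.isLt; omega⟩)

/-- The Heisenberg group multiplication. -/
def hmul {n : ℕ} (x y : Heis n) : Heis n := (x.1 + y.1, x.2 + y.2 + symp x.1 y.1)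

/-- The Heisenberg group inverse, `x⁻¹ = -x`. -/
def hinv {n : ℕ} (x : Heis n) : Heis n := (-x.1, -x.2)

/-- The identity element `e = 0`. -/
def eH {n : ℕ} : Heis n := (0, 0)

/-- The Korányi norm `‖x‖_H = (|x'|⁴ + x_{2n+1}²)^{1/4}`. -/
def KNorm {n : ℕ} (x : Heis n) : ℝ := (‖x.1‖ ^ 4 + x.2 ^ 2) ^ ((1 : ℝ) / 4)

/-- The Korányi metric `d_H(x,y) = ‖x⁻¹·y‖_H`. -/
def dH {n : ℕ} (x y : Heis n) : ℝ := KNorm (hmul (hinv x) y)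

/-- The closed `d_H`-ball of center `x` and radius `r`. -/
def ballH {n : ℕ} (x : Heis n) (r : ℝ) : Set (Heis n) := {y | dH x y ≤ r}

/-- The support of a measure with respect to the Korányi metric. -/
def suppH {n : ℕ} (μ : Measure (Heis n)) : Set (Heis n) := {x | ∀ r > 0, 0 < μ (ballH x r)}

/-- A Radon measure is uniformly distributed if all balls centered on its support of
a common radius have the same measure. -/
def UniformlyDistributed {n : ℕ} (μ : Measure (Heis n)) : Prop :=
  ∀ x ∈ suppH μ, ∀ y ∈ suppH μ, ∀ r : ℝ, 0 < r → μ (ballH x r) = μ (ballH y r)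

/-- The dilations `δ_r(x', x_{2n+1}) = (r x', r² x_{2n+1})`. -/
def dil {n : ℕ} (r : ℝ) (x : Heis n) : Heis n := (r • x.1, r ^ 2 * x.2)

/-- `d_H`-diameter of a set, as an extended real. -/
def ediamH {n : ℕ} (E : Set (Heis n)) : ℝ≥0∞ :=
  ⨆ x ∈ E, ⨆ y ∈ E, ENNReal.ofReal (dH x y)

/-- The `s`-dimensional Hausdorff measure built from the Korányi metric `d_H`. -/
def hausH {n : ℕ} (s : ℝ) (E : Set (Heis n)) : ℝ≥0∞ :=
  ⨆ (δ : ℝ) (_ : 0 < δ), ⨅ (t : ℕ → Set (Heis n)) (_ : E ⊆ ⋃ i, t i)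
    (_ : ∀ i, ediamH (t i) ≤ ENNReal.ofReal δ), ∑' i, ediamH (t i) ^ s

/-- The Hausdorff dimension with respect to the Korányi metric `d_H`. -/
def dimHH {n : ℕ} (E : Set (Heis n)) : ℝ≥0∞ :=
  ⨆ (d : ℝ≥0) (_ : hausH (d : ℝ) E = ⊤), (d : ℝ≥0∞)

/-- `Θˢ(μ,x) = d`: the `s`-density of `μ` at `x` exists and equals `d`. -/
def HasDensity {n : ℕ} (μ : Measure (Heis n)) (s : ℝ) (x : Heis n) (d : ℝ≥0∞) : Prop :=
  Tendsto (fun r : ℝ => μ (ballH x r) / ENNReal.ofReal (r ^ s)) (nhdsWithin 0 (Ioi 0)) (nhds d)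



/-- germs of analytic functions at `x` vanishing on `S` near `x`. -/
def VanishGerm {E : Type*} [NormedAddCommGroup E] [NormedSpace ℝ E] (S : Set E) (x : E)
    (f : E → ℝ) : Prop :=
  ContDiffAt ℝ (⊤ : WithTop ℕ∞) f x ∧ ∀ᶠ y in nhds x, y ∈ S → f y = 0

def diffSpace {E : Type*} [NormedAddCommGroup E] [NormedSpace ℝ E] (S : Set E) (x : E) :
    Submodule ℝ (E →L[ℝ] ℝ) where
  carrier := {l | ∃ f, VanishGerm S x f ∧ fderiv ℝ f x = l}
  add_mem' := by
    rintro a b ⟨f, hf, rfl⟩ ⟨g, hg, rfl⟩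
    refine ⟨f + g, ⟨hf.1.add hg.1, ?_⟩, ?_⟩
    · filter_upwards [hf.2, hg.2] with y h1 h2 hy
      simp [h1 hy, h2 hy]
    · exact fderiv_add (hf.1.differentiableAt (by simp)) (hg.1.differentiableAt (by simp))
  zero_mem' := ⟨0, ⟨contDiffAt_const, by simp⟩, by simp⟩
  smul_mem' := by
    rintro c a ⟨f, hf, rfl⟩
    refine ⟨c • f, ⟨contDiffAt_const.smul hf.1, ?_⟩, ?_⟩
    · filter_upwards [hf.2] with y h1 hy
      simp [h1 hy]
    · exact fderiv_const_smul (hf.1.differentiableAt (by simp)) c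

lemma VanishGerm.eventually {E : Type*} [NormedAddCommGroup E] [NormedSpace ℝ E] {S : Set E} {x : E}
    {f : E → ℝ} (h : VanishGerm S x f) : ∀ᶠ y in nhds x, VanishGerm S y f := by
  filter_upwards [h.1.eventually (by simp), h.2.eventually_nhds] with y h1 h2
  exact ⟨h1, h2⟩

/-- an analytic function with all iterated derivatives vanishing vanishes locally. -/
lemma eventually_zero_of_iteratedFDeriv {E : Type*} [NormedAddCommGroup E] [NormedSpace ℝ E]
    {f : E → ℝ} {x : E} (hf : AnalyticAt ℝ f x) (h : ∀ k, iteratedFDeriv ℝ k f x = 0) :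
    ∀ᶠ y in nhds x, f y = 0 := by
  obtain ⟨p, r, hp⟩ := hf
  have h1 : ∀ᶠ y in nhds (0:E), y ∈ Metric.eball (0:E) r :=
    Metric.eball_mem_nhds _ hp.r_pos
  have h2 : Tendsto (fun y => y - x) (nhds x) (nhds (0:E)) := by
    have : Tendsto (fun y => y - x) (nhds x) (nhds (x - x)) := tendsto_id.sub_const x
    simpa using this
  filter_upwards [h2.eventually h1] with y hy
  have := hp.hasSum_iteratedFDeriv hy
  simp only [h, zero_apply, smul_zero, add_sub_cancel] at this
  exact this.unique hasSum_zero


lemma surjective_pi_of_linearIndependent {E : Type*} [AddCommGroup E] [Module ℝ E] {d : ℕ}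
    (l : Fin d → E →ₗ[ℝ] ℝ) (hl : LinearIndependent ℝ l) :
    Function.Surjective (LinearMap.pi l) := by
  rw [← LinearMap.range_eq_top]
  by_contra hne
  obtain ⟨g, hg, hg2⟩ := Submodule.exists_le_ker_of_lt_top _ (lt_top_iff_ne_top.2 hne)
  apply hg
  have key : ∑ i, g (Pi.single i 1) • l i = 0 := by
    ext v
    have h1 : LinearMap.pi l v ∈ LinearMap.ker g := hg2 ⟨v, rfl⟩
    rw [LinearMap.mem_ker, LinearMap.pi_apply_eq_sum_univ] at h1
    simp only [LinearMap.coe_sum, Finset.sum_apply, LinearMap.smul_apply, LinearMap.zero_apply]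
    rw [← h1]
    apply Finset.sum_congr rfl
    intro i _
    simp only [LinearMap.pi_apply, smul_eq_mul, mul_comm]
    congr 2
    ext j
    by_cases hij : i = j
    · subst hij; simp
    · simp [hij, Ne.symm hij]
  have := Fintype.linearIndependent_iff.1 hl _ key
  apply LinearMap.pi_ext'
  intro i
  ext
  simpa using this i

lemma exists_local_chart {E : Type*} [NormedAddCommGroup E] [NormedSpace ℝ E]
    [FiniteDimensional ℝ E] (p : E) (S : Set E) (d : ℕ) (f : Fin d → E → ℝ)
    (hf : ∀ i, VanishGerm S p (f i)) (hp : p ∈ S)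
    (hli : LinearIndependent ℝ (fun i => fderiv ℝ (f i) p)) :
    ∃ (m : ℕ) (π : E →L[ℝ] (Fin m → ℝ)) (φ : (Fin m → ℝ) → E),
      ContDiffAt ℝ (⊤ : WithTop ℕ∞) φ (π p) ∧ φ (π p) = p ∧
      (∀ᶠ w in nhds (π p), π (φ w) = w) ∧
      (∀ᶠ w in nhds (π p), ∀ i, f i (φ w) = 0) ∧
      (∀ᶠ y in nhds p, y ∈ S → φ (π y) = y) := by
  have : CompleteSpace E := FiniteDimensional.complete ℝ E
  let l : Fin d → E →ₗ[ℝ] ℝ := fun i => (fderiv ℝ (f i) p : E →ₗ[ℝ] ℝ)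
  have hl : LinearIndependent ℝ l :=
    hli.map' (ContinuousLinearMap.coeLM ℝ) (LinearMap.ker_eq_bot.2 ContinuousLinearMap.coe_injective)
  have hsurj := surjective_pi_of_linearIndependent l hl
  let K := LinearMap.ker (LinearMap.pi l)
  let m := Module.finrank ℝ K
  let e : K ≃ₗ[ℝ] (Fin m → ℝ) := (Module.finBasis ℝ K).equivFun
  obtain ⟨q, hq⟩ := LinearMap.exists_leftInverse_of_injective K.subtype (Submodule.ker_subtype K)
  let π₀ : E →ₗ[ℝ] (Fin m → ℝ) := e.toLinearMap ∘ₗ q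
  let π : E →L[ℝ] (Fin m → ℝ) := LinearMap.toContinuousLinearMap π₀
  let L : E →ₗ[ℝ] (Fin d → ℝ) × (Fin m → ℝ) := (LinearMap.pi l).prod π₀
  have hLinj : Function.Injective L := by
    rw [← LinearMap.ker_eq_bot, LinearMap.ker_eq_bot']
    intro v hv
    have h1 : LinearMap.pi l v = 0 := congrArg Prod.fst hv
    have h2 : e (q v) = 0 := congrArg Prod.snd hv
    have h3 : q v = 0 := by simpa using h2
    have h4 : q (K.subtype ⟨v, h1⟩) = ⟨v, h1⟩ := LinearMap.congr_fun hq _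
    have h5 : (⟨v, h1⟩ : K) = 0 := by rw [← h4]; exact h3
    exact congrArg Subtype.val h5
  have hfr : Module.finrank ℝ E = Module.finrank ℝ ((Fin d → ℝ) × (Fin m → ℝ)) := by
    have := LinearMap.finrank_range_add_finrank_ker (LinearMap.pi l)
    rw [LinearMap.range_eq_top.2 hsurj, finrank_top] at this
    rw [← this]
    simp [m, K]
  let Le : E ≃L[ℝ] (Fin d → ℝ) × (Fin m → ℝ) :=
    (LinearEquiv.ofInjectiveOfFinrankEq L hLinj hfr).toContinuousLinearEquiv
  let Φ : E → (Fin d → ℝ) × (Fin m → ℝ) := fun y => (fun i => f i y, π y)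
  have hΦ : ContDiffAt ℝ (⊤ : WithTop ℕ∞) Φ p :=
    (contDiffAt_pi.2 fun i => (hf i).1).prodMk π.contDiff.contDiffAt
  have hΦ' : HasFDerivAt Φ (Le : E →L[ℝ] (Fin d → ℝ) × (Fin m → ℝ)) p := by
    have h1 : HasFDerivAt Φ ((ContinuousLinearMap.pi fun i => fderiv ℝ (f i) p).prod π) p :=
      (hasFDerivAt_pi.2 fun i =>
        ((hf i).1.differentiableAt (by simp)).hasFDerivAt).prodMk π.hasFDerivAt
    have h2 : (Le : E →L[ℝ] (Fin d → ℝ) × (Fin m → ℝ)) =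
        (ContinuousLinearMap.pi fun i => fderiv ℝ (f i) p).prod π :=
      ContinuousLinearMap.ext fun v => rfl
    rw [h2]; exact h1
  have hs := hΦ.hasStrictFDerivAt' hΦ' (by simp)
  have hΦp : Φ p = (0, π p) := by
    ext i
    · exact (hf i).2.self_of_nhds hp
    · rfl
  let Ψ := hΦ.localInverse hΦ' (by simp)
  have hc : Tendsto (fun w : Fin m → ℝ => ((0 : Fin d → ℝ), w)) (nhds (π p)) (nhds (Φ p)) := by
    rw [hΦp]
    exact (Continuous.prodMk_right 0).tendsto _
  have hr : ∀ᶠ w in nhds (π p), Φ (Ψ (0, w)) = (0, w) := hc.eventually hs.eventually_right_inverse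
  refine ⟨m, π, fun w => Ψ (0, w), ?_, ?_, ?_, ?_, ?_⟩
  · have h1 : ContDiffAt ℝ (⊤ : WithTop ℕ∞) Ψ (0, π p) := hΦp ▸ hΦ.to_localInverse hΦ' (by simp)
    exact h1.comp (π p) (contDiffAt_const.prodMk contDiffAt_id)
  · have := hΦ.localInverse_apply_image hΦ' (by simp)
    rw [hΦp] at this
    exact this
  · filter_upwards [hr] with w hw
    exact congrArg Prod.snd hw
  · filter_upwards [hr] with w hw i
    exact congrFun (congrArg Prod.fst hw) i
  · have h0 : ∀ᶠ y in nhds p, ∀ i, y ∈ S → f i y = 0 := eventually_all.2 fun i => (hf i).2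
    filter_upwards [hs.eventually_left_inverse, h0] with y hy h0 hyS
    have : Φ y = (0, π y) := by
      ext i
      · exact h0 i hyS
      · rfl
    rw [← this]
    exact hy

lemma vanishGerm_deriv {E : Type*} [NormedAddCommGroup E] [NormedSpace ℝ E]
    [FiniteDimensional ℝ E] (p : E) (S : Set E) (d : ℕ) (f : Fin d → E → ℝ)
    (hf : ∀ i, VanishGerm S p (f i))
    (hli : LinearIndependent ℝ (fun i => fderiv ℝ (f i) p))
    (hmax : ∀ y ∈ S, Module.finrank ℝ (diffSpace S y) ≤ d)
    (m : ℕ) (π : E →L[ℝ] (Fin m → ℝ)) (φ : (Fin m → ℝ) → E)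
    (h1 : ContDiffAt ℝ (⊤ : WithTop ℕ∞) φ (π p)) (h2 : φ (π p) = p)
    (h4 : ∀ᶠ w in nhds (π p), ∀ i, f i (φ w) = 0)
    (h5 : ∀ᶠ y in nhds p, y ∈ S → φ (π y) = y)
    (g : E → ℝ) (hg : VanishGerm S p g) (v : Fin m → ℝ) :
    VanishGerm S p (fun y => fderiv ℝ (g ∘ φ) (π y) v) := by
  have hgφ : ContDiffAt ℝ (⊤ : WithTop ℕ∞) (g ∘ φ) (π p) := by
    apply ContDiffAt.comp _ _ h1
    rw [h2]; exact hg.1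
  constructor
  · have : ContDiffAt ℝ (⊤ : WithTop ℕ∞) (fderiv ℝ (g ∘ φ)) (π p) := hgφ.fderiv_right (by simp)
    have h6 := this.clm_apply (contDiffAt_const (c := v))
    exact h6.comp p π.contDiff.contDiffAt
  · have hπ : Tendsto π (nhds p) (nhds (π p)) := π.continuous.tendsto p
    have hcont : ContinuousAt (fun y => fun i => fderiv ℝ (f i) y) p :=
      continuousAt_pi.2 fun i => ((hf i).1.fderiv_right (m := ⊤) (by simp)).continuousAt
    have hopen : ∀ᶠ y in nhds p, LinearIndependent ℝ (fun i => fderiv ℝ (f i) y) :=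
      hcont.eventually (isOpen_setOfPred_linearIndependent.mem_nhds hli)
    have hfe : ∀ᶠ y in nhds p, ∀ i, VanishGerm S y (f i) := eventually_all.2 fun i => (hf i).eventually
    filter_upwards [h5, hg.eventually, hfe, hopen, hπ.eventually h4.eventually_nhds,
      hπ.eventually (h1.eventually (by simp))] with y a1 a2 a3 a4 a5 a6 hy
    have hφd : DifferentiableAt ℝ φ (π y) := a6.differentiableAt (by simp)
    have hspan : Submodule.span ℝ (range fun i => fderiv ℝ (f i) y) = diffSpace S y := by
      apply Submodule.eq_of_le_of_finrank_le
      · rw [Submodule.span_le]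
        rintro _ ⟨i, rfl⟩
        exact ⟨f i, a3 i, rfl⟩
      · rw [finrank_span_eq_card a4]
        simpa using hmax y hy
    have hmem : fderiv ℝ g y ∈ Submodule.span ℝ (range fun i => fderiv ℝ (f i) y) := by
      rw [hspan]; exact ⟨g, a2, rfl⟩
    have hall : ∀ l ∈ Submodule.span ℝ (range fun i => fderiv ℝ (f i) y),
        l (fderiv ℝ φ (π y) v) = 0 := by
      intro l hl
      induction hl using Submodule.span_induction with
      | mem x hx =>
        obtain ⟨i, rfl⟩ := hx
        have b1 : fderiv ℝ (f i ∘ φ) (π y) = 0 := by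
          have : (f i ∘ φ) =ᶠ[nhds (π y)] fun _ => 0 := by
            filter_upwards [a5] with w hw using hw i
          rw [this.fderiv_eq]; simp
        rw [fderiv_comp _ (by rw [a1 hy]; exact (a3 i).1.differentiableAt (by simp)) hφd, a1 hy] at b1
        exact DFunLike.congr_fun b1 v
      | zero => simp
      | add x y _ _ hx hy => simp [hx, hy]
      | smul c x _ hx => simp [hx]
    rw [fderiv_comp _ (by rw [a1 hy]; exact a2.1.differentiableAt (by simp)) hφd, a1 hy]
    exact hall _ hmem

lemma exists_submodule_basis {V : Type*} [AddCommGroup V] [Module ℝ V] [FiniteDimensional ℝ V]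
    (D : Submodule ℝ V) :
    ∃ b : Fin (Module.finrank ℝ D) → V, (∀ i, b i ∈ D) ∧ LinearIndependent ℝ b := by
  let b := Module.finBasis ℝ D
  exact ⟨fun i => b i, fun i => (b i).2,
    b.linearIndependent.map' (Submodule.subtype _) (Submodule.ker_subtype _)⟩

lemma exists_germ_basis {E : Type*} [NormedAddCommGroup E] [NormedSpace ℝ E]
    [FiniteDimensional ℝ E] (S : Set E) (p : E) :
    ∃ f : Fin (Module.finrank ℝ (diffSpace S p)) → E → ℝ, (∀ i, VanishGerm S p (f i)) ∧
      LinearIndependent ℝ (fun i => fderiv ℝ (f i) p) := by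
  obtain ⟨b, hb, hli⟩ := exists_submodule_basis (diffSpace S p)
  have hb' : ∀ i, ∃ f, VanishGerm S p f ∧ fderiv ℝ f p = b i := hb
  choose f hf hfb using hb'
  refine ⟨f, hf, ?_⟩
  have h1 : (fun i => fderiv ℝ (f i) p) = b := funext hfb
  rw [h1]
  exact hli

theorem exists_chart {E : Type*} [NormedAddCommGroup E] [NormedSpace ℝ E]
    [FiniteDimensional ℝ E] (S : Set E) (hSne : S.Nonempty) (𝓕 : Set (E → ℝ))
    (hF : ∀ f ∈ 𝓕, ∀ x, AnalyticAt ℝ f x) (hS : S = {x | ∀ f ∈ 𝓕, f x = 0}) :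
    ∃ (m : ℕ) (B : Set (Fin m → ℝ)) (U : Set E) (φ : (Fin m → ℝ) → E) (π : E →L[ℝ] (Fin m → ℝ)),
      IsOpen B ∧ B.Nonempty ∧ IsOpen U ∧ (∀ w ∈ B, ContDiffAt ℝ (⊤ : WithTop ℕ∞) φ w) ∧
      (∀ w ∈ B, π (φ w) = w) ∧ S ∩ U = φ '' B := by
  have : CompleteSpace E := FiniteDimensional.complete ℝ E
  obtain ⟨p, hpS, hmax⟩ : ∃ p ∈ S, ∀ y ∈ S,
      Module.finrank ℝ (diffSpace S y) ≤ Module.finrank ℝ (diffSpace S p) := by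
    have hb : BddAbove ((fun y => Module.finrank ℝ (diffSpace S y)) '' S) := by
      refine ⟨Module.finrank ℝ (E →L[ℝ] ℝ), ?_⟩
      rintro _ ⟨y, _, rfl⟩
      exact Submodule.finrank_le _
    obtain ⟨p, hp, h⟩ := Nat.sSup_mem (hSne.image _) hb
    refine ⟨p, hp, fun y hy => ?_⟩
    have := le_csSup hb (mem_image_of_mem _ hy)
    simp only at h this
    omega
  set d := Module.finrank ℝ (diffSpace S p) with hd
  obtain ⟨f, hf, hli⟩ := exists_germ_basis S p
  obtain ⟨m, π, φ, h1, h2, h3, h4, h5⟩ := exists_local_chart p S d f hf hpS hli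
  have hder := vanishGerm_deriv p S d f hf hli hmax m π φ h1 h2 h4 h5
  have hzero : ∀ k, ∀ g, VanishGerm S p g → iteratedFDeriv ℝ k (g ∘ φ) (π p) = 0 := by
    intro k
    induction k with
    | zero =>
      intro g hg
      ext
      simp [h2, hg.2.self_of_nhds hpS]
    | succ k ih =>
      intro g hg
      ext w
      rw [iteratedFDeriv_succ_apply_right]
      have hgφ : ContDiffAt ℝ (⊤ : WithTop ℕ∞) (g ∘ φ) (π p) := by
        apply ContDiffAt.comp _ _ h1
        rw [h2]; exact hg.1
      have h6 : ContDiffAt ℝ (⊤ : WithTop ℕ∞) (fderiv ℝ (g ∘ φ)) (π p) :=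
        hgφ.fderiv_right (by simp)
      have h7 := ih _ (hder g hg (w (Fin.last k)))
      have h8 : ((fun y => fderiv ℝ (g ∘ φ) (π y) (w (Fin.last k))) ∘ φ) =ᶠ[nhds (π p)]
          (ContinuousLinearMap.apply ℝ ℝ (w (Fin.last k))) ∘ (fderiv ℝ (g ∘ φ)) := by
        filter_upwards [h3] with y hy
        simp [hy]
      rw [(h8.iteratedFDeriv ℝ k).eq_of_nhds, ContinuousLinearMap.iteratedFDeriv_comp_left _ (n := ⊤) h6 (by simp)] at h7
      exact DFunLike.congr_fun h7 (Fin.init w)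
  have hloc : ∀ g ∈ 𝓕, ∀ᶠ w in nhds (π p), g (φ w) = 0 := by
    intro g hg
    have hv : VanishGerm S p g := by
      refine ⟨(hF g hg p).contDiffAt, Eventually.of_forall fun y hy => ?_⟩
      rw [hS] at hy
      exact hy g hg
    apply eventually_zero_of_iteratedFDeriv (f := g ∘ φ) _ (fun k => hzero k g hv)
    apply AnalyticAt.comp
    · exact hF g hg _
    · exact h1.analyticAt
  obtain ⟨U₀, hU₀, hU₀o, hpU₀⟩ := eventually_nhds_iff.1 h5
  have h6 : ∀ᶠ w in nhds (π p), φ w ∈ U₀ :=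
    h1.continuousAt.eventually (by rw [h2]; exact hU₀o.mem_nhds hpU₀)
  obtain ⟨ε, hε, hB⟩ := Metric.eventually_nhds_iff_ball.1 ((h1.eventually (by simp)).and (h3.and h6))
  refine ⟨m, Metric.ball (π p) ε, U₀ ∩ π ⁻¹' Metric.ball (π p) ε, φ, π, Metric.isOpen_ball,
    ⟨π p, Metric.mem_ball_self hε⟩, hU₀o.inter (Metric.isOpen_ball.preimage π.continuous),
    fun w hw => (hB w hw).1, fun w hw => (hB w hw).2.1, ?_⟩
  ext y
  constructor
  · rintro ⟨hy, hyU, hyB⟩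
    exact ⟨π y, hyB, hU₀ y hyU hy⟩
  · rintro ⟨w, hw, rfl⟩
    refine ⟨?_, (hB w hw).2.2, ?_⟩
    · rw [hS]
      intro g hg
      have han : AnalyticOnNhd ℝ (g ∘ φ) (Metric.ball (π p) ε) := fun w hw =>
        AnalyticAt.comp (hF g hg _) (hB w hw).1.analyticAt
      exact han.eqOn_zero_of_preconnected_of_eventuallyEq_zero
        (convex_ball _ _).isPreconnected (Metric.mem_ball_self hε) (hloc g hg) hw
    · simp only [mem_preimage, (hB w hw).2.1]
      exact hw


lemma sum_two_mul {n : ℕ} (f : Fin (2 * n) → ℝ) : ∑ i, f i =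
    ∑ j : Fin n, (f ⟨j.1, by have := j.isLt; omega⟩ + f ⟨j.1 + n, by have := j.isLt; omega⟩) := by
  rw [← Equiv.sum_comp (finCongr (two_mul n).symm) f, Fin.sum_univ_add, ← Finset.sum_add_distrib]
  apply Finset.sum_congr rfl
  intro j _
  congr 2
  ext
  simp [add_comm]

lemma symp_add_right {n : ℕ} (x y z : EuclideanSpace ℝ (Fin (2 * n))) :
    symp x (y + z) = symp x y + symp x z := by
  simp only [symp, ← mul_add, ← Finset.sum_add_distrib]
  congr 1
  apply Finset.sum_congr rfl
  intro j _
  simp only [PiLp.add_apply]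
  ring

lemma symp_smul_right {n : ℕ} (c : ℝ) (x y : EuclideanSpace ℝ (Fin (2 * n))) :
    symp x (c • y) = c * symp x y := by
  simp only [symp, mul_left_comm c, Finset.mul_sum]
  apply Finset.sum_congr rfl
  intro j _
  simp only [PiLp.smul_apply, smul_eq_mul]
  ring

lemma symp_swap {n : ℕ} (x y : EuclideanSpace ℝ (Fin (2 * n))) : symp y x = - symp x y := by
  simp only [symp, ← mul_neg, ← Finset.sum_neg_distrib]
  congr 1
  apply Finset.sum_congr rfl
  intro j _
  ring

lemma symp_self {n : ℕ} (x : EuclideanSpace ℝ (Fin (2 * n))) : symp x x = 0 := by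
  have := symp_swap x x
  linarith

lemma symp_add_left {n : ℕ} (x y z : EuclideanSpace ℝ (Fin (2 * n))) :
    symp (x + y) z = symp x z + symp y z := by
  rw [symp_swap, symp_add_right, symp_swap x, symp_swap y]; ring

lemma symp_smul_left {n : ℕ} (c : ℝ) (x y : EuclideanSpace ℝ (Fin (2 * n))) :
    symp (c • x) y = c * symp x y := by
  rw [symp_swap, symp_smul_right, symp_swap x]; ring

lemma symp_neg_left {n : ℕ} (x y : EuclideanSpace ℝ (Fin (2 * n))) :
    symp (-x) y = - symp x y := by
  have := symp_smul_left (-1) x y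
  simpa using this

lemma symp_neg_right {n : ℕ} (x y : EuclideanSpace ℝ (Fin (2 * n))) :
    symp x (-y) = - symp x y := by
  have := symp_smul_right (-1) x y
  simpa using this

lemma symp_sub_right {n : ℕ} (x y z : EuclideanSpace ℝ (Fin (2 * n))) :
    symp x (y - z) = symp x y - symp x z := by
  rw [sub_eq_add_neg, symp_add_right, symp_neg_right]; ring

lemma symp_sub_left {n : ℕ} (x y z : EuclideanSpace ℝ (Fin (2 * n))) :
    symp (x - y) z = symp x z - symp y z := by
  rw [sub_eq_add_neg, symp_add_left, symp_neg_left]; ring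

/-- complexification of a vector -/
def cvec {n : ℕ} (x : EuclideanSpace ℝ (Fin (2 * n))) : EuclideanSpace ℂ (Fin n) :=
  WithLp.toLp 2 fun j => ⟨x ⟨j.1, by have := j.isLt; omega⟩, x ⟨j.1 + n, by have := j.isLt; omega⟩⟩

lemma norm_cvec {n : ℕ} (x : EuclideanSpace ℝ (Fin (2 * n))) : ‖cvec x‖ = ‖x‖ := by
  rw [EuclideanSpace.norm_eq, EuclideanSpace.norm_eq, sum_two_mul]
  congr 1
  apply Finset.sum_congr rfl
  intro j _
  rw [← Complex.normSq_eq_norm_sq]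
  simp [cvec, Complex.normSq_apply]
  ring

lemma inner_sq_add_symp_sq {n : ℕ} (x y : EuclideanSpace ℝ (Fin (2 * n))) :
    (inner ℝ x y) ^ 2 + (symp x y / 2) ^ 2 ≤ (‖x‖ * ‖y‖) ^ 2 := by
  have h := norm_inner_le_norm (𝕜 := ℂ) (cvec x) (cvec y)
  rw [norm_cvec, norm_cvec] at h
  have h1 : (inner ℂ (cvec x) (cvec y) : ℂ).re = inner ℝ x y := by
    simp only [PiLp.inner_apply, cvec, Complex.re_sum]
    rw [sum_two_mul]
    apply Finset.sum_congr rfl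
    intro j _
    simp
  have h2 : (inner ℂ (cvec x) (cvec y) : ℂ).im = - (symp x y / 2) := by
    simp only [PiLp.inner_apply, cvec, Complex.im_sum, symp]
    rw [neg_mul, neg_div, neg_neg, mul_div_cancel_left₀ _ (two_ne_zero)]
    apply Finset.sum_congr rfl
    intro j _
    simp
    ring
  have h3 := Complex.sq_norm (inner ℂ (cvec x) (cvec y))
  rw [Complex.normSq_apply, h1, h2] at h3
  have h4 := pow_le_pow_left₀ (norm_nonneg _) h 2
  nlinarith

lemma abs_symp_le {n : ℕ} (x y : EuclideanSpace ℝ (Fin (2 * n))) :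
    |symp x y| ≤ 2 * (‖x‖ * ‖y‖) := by
  have := inner_sq_add_symp_sq x y
  have h2 : (symp x y / 2) ^ 2 ≤ (‖x‖ * ‖y‖) ^ 2 := by nlinarith [sq_nonneg (inner ℝ x y : ℝ)]
  have h3 := abs_le_of_sq_le_sq h2 (by positivity)
  rw [abs_div, abs_two] at h3
  linarith

lemma KNorm_nonneg {n : ℕ} (x : Heis n) : 0 ≤ KNorm x := by
  unfold KNorm; positivity

lemma KNorm_pow {n : ℕ} (x : Heis n) : KNorm x ^ 4 = ‖x.1‖ ^ 4 + x.2 ^ 2 := by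
  unfold KNorm
  rw [← Real.rpow_natCast, ← Real.rpow_mul (by positivity)]
  norm_num

lemma norm_le_KNorm {n : ℕ} (x : Heis n) : ‖x.1‖ ≤ KNorm x := by
  have := KNorm_pow x
  apply le_of_pow_le_pow_left₀ (n := 4) (by norm_num) (KNorm_nonneg x)
  nlinarith [sq_nonneg x.2]

lemma abs_le_KNorm_sq {n : ℕ} (x : Heis n) : |x.2| ≤ KNorm x ^ 2 := by
  have := KNorm_pow x
  have h1 : 0 ≤ ‖x.1‖ ^ 4 := by positivity
  have h2 : x.2 ^ 2 ≤ (KNorm x ^ 2) ^ 2 := by nlinarith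
  exact abs_le_of_sq_le_sq h2 (by positivity)

lemma KNorm_le_of {n : ℕ} {x : Heis n} {a : ℝ} (ha : 0 ≤ a) (h1 : ‖x.1‖ ≤ a) (h2 : |x.2| ≤ a ^ 2) :
    KNorm x ≤ 2 * a := by
  have := KNorm_pow x
  apply le_of_pow_le_pow_left₀ (n := 4) (by norm_num) (by positivity)
  rw [this]
  have h3 := pow_le_pow_left₀ (norm_nonneg _) h1 4
  have h4 := pow_le_pow_left₀ (abs_nonneg _) h2 2
  rw [sq_abs] at h4
  nlinarith [pow_nonneg ha 4]

lemma KNorm_hmul_le {n : ℕ} (a b : Heis n) : KNorm (hmul a b) ≤ KNorm a + KNorm b := by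
  have ha := KNorm_nonneg a
  have hb := KNorm_nonneg b
  apply le_of_pow_le_pow_left₀ (n := 4) (by norm_num) (by positivity)
  rw [KNorm_pow]
  simp only [hmul]
  set α := KNorm a with hα
  set β := KNorm b with hβ
  set s := symp a.1 b.1 with hs
  set i : ℝ := inner ℝ a.1 b.1 with hi
  have hz1 : ‖(⟨‖a.1‖ ^ 2, a.2⟩ : ℂ)‖ = α ^ 2 := by
    have h := Complex.sq_norm (⟨‖a.1‖ ^ 2, a.2⟩ : ℂ)
    rw [Complex.normSq_apply] at h
    have h' := KNorm_pow a
    rw [← hα] at h'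
    rw [← abs_of_nonneg (norm_nonneg (⟨‖a.1‖ ^ 2, a.2⟩ : ℂ)), ← abs_of_nonneg (sq_nonneg α)]
    rw [← sq_eq_sq_iff_abs_eq_abs, h]
    simp only
    nlinarith
  have hz2 : ‖(⟨‖b.1‖ ^ 2, b.2⟩ : ℂ)‖ = β ^ 2 := by
    have h := Complex.sq_norm (⟨‖b.1‖ ^ 2, b.2⟩ : ℂ)
    rw [Complex.normSq_apply] at h
    have h' := KNorm_pow b
    rw [← hβ] at h'
    rw [← abs_of_nonneg (norm_nonneg (⟨‖b.1‖ ^ 2, b.2⟩ : ℂ)), ← abs_of_nonneg (sq_nonneg β)]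
    rw [← sq_eq_sq_iff_abs_eq_abs, h]
    simp only
    nlinarith
  have hz3 : ‖(⟨2 * i, s⟩ : ℂ)‖ ≤ 2 * (α * β) := by
    have h := Complex.sq_norm (⟨2 * i, s⟩ : ℂ)
    rw [Complex.normSq_apply] at h
    have h1 := inner_sq_add_symp_sq a.1 b.1
    rw [← hs, ← hi] at h1
    have h2 : (‖a.1‖ * ‖b.1‖) ^ 2 ≤ (α * β) ^ 2 := by
      have := mul_le_mul (norm_le_KNorm a) (norm_le_KNorm b) (norm_nonneg _) ha
      exact pow_le_pow_left₀ (by positivity) this 2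
    apply le_of_sq_le_sq _ (by positivity)
    rw [h]
    simp only
    nlinarith
  have htri : ‖(⟨‖a.1‖ ^ 2, a.2⟩ : ℂ) + ⟨‖b.1‖ ^ 2, b.2⟩ + ⟨2 * i, s⟩‖ ≤ (α + β) ^ 2 := by
    have h1 := norm_add_le ((⟨‖a.1‖ ^ 2, a.2⟩ : ℂ) + ⟨‖b.1‖ ^ 2, b.2⟩) ⟨2 * i, s⟩
    have h2 := norm_add_le (⟨‖a.1‖ ^ 2, a.2⟩ : ℂ) ⟨‖b.1‖ ^ 2, b.2⟩
    nlinarith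
  have h := Complex.sq_norm ((⟨‖a.1‖ ^ 2, a.2⟩ : ℂ) + ⟨‖b.1‖ ^ 2, b.2⟩ + ⟨2 * i, s⟩)
  rw [Complex.normSq_apply] at h
  have h5 := pow_le_pow_left₀ (norm_nonneg _) htri 2
  rw [h] at h5
  simp only [Complex.add_re, Complex.add_im] at h5
  have h6 : ‖a.1 + b.1‖ ^ 2 = ‖a.1‖ ^ 2 + 2 * i + ‖b.1‖ ^ 2 := norm_add_sq_real _ _
  have h7 : ‖a.1 + b.1‖ ^ 4 = (‖a.1‖ ^ 2 + 2 * i + ‖b.1‖ ^ 2) ^ 2 := by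
    rw [← h6]; ring
  rw [h7]
  nlinarith

/-- the vertical component -/
def vert {n : ℕ} (y v : Heis n) : ℝ := v.2 - symp y.1 v.1

lemma hinv_hmul {n : ℕ} (x y : Heis n) : hmul (hinv x) y = (y.1 - x.1, vert x (y - x)) := by
  ext1
  · simp [hmul, hinv]; abel
  · simp [hmul, hinv, vert, symp_neg_left, symp_sub_right, symp_self]; ring

lemma vert_sub_swap {n : ℕ} (x y : Heis n) : vert y (x - y) = - vert x (y - x) := by
  simp only [vert, Prod.fst_sub, Prod.snd_sub, symp_sub_right, symp_self, symp_swap x.1 y.1]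
  ring

lemma dH_pow {n : ℕ} (x y : Heis n) : dH x y ^ 4 = ‖y.1 - x.1‖ ^ 4 + vert x (y - x) ^ 2 := by
  rw [dH, KNorm_pow, hinv_hmul]

lemma dH_nonneg {n : ℕ} (x y : Heis n) : 0 ≤ dH x y := KNorm_nonneg _

lemma dH_comm {n : ℕ} (x y : Heis n) : dH x y = dH y x := by
  apply (pow_left_inj₀ (dH_nonneg x y) (dH_nonneg y x) (n := 4) (by norm_num)).1
  rw [dH_pow, dH_pow, vert_sub_swap, norm_sub_rev]
  ring

lemma hmul_assoc {n : ℕ} (x y z : Heis n) : hmul (hmul x y) z = hmul x (hmul y z) := by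
  ext1
  · simp [hmul, add_assoc]
  · simp [hmul, symp_add_left, symp_add_right]; ring

lemma dH_left {n : ℕ} (a x y : Heis n) : dH (hmul a x) (hmul a y) = dH x y := by
  unfold dH
  congr 1
  rw [hinv_hmul, hinv_hmul]
  ext1
  · simp [hmul]
  · simp [hmul, vert, symp_add_left, symp_sub_right, symp_self]
    ring

lemma dH_dil {n : ℕ} {r : ℝ} (hr : 0 ≤ r) (x y : Heis n) : dH (dil r x) (dil r y) = r * dH x y := by
  apply (pow_left_inj₀ (dH_nonneg _ _) (mul_nonneg hr (dH_nonneg _ _)) (n := 4) (by norm_num)).1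
  rw [mul_pow, dH_pow, dH_pow]
  have h1 : (dil r y).1 - (dil r x).1 = r • (y.1 - x.1) := by simp [dil, smul_sub]
  have h2 : vert (dil r x) (dil r y - dil r x) = r ^ 2 * vert x (y - x) := by
    simp [vert, dil, symp_sub_right, symp_smul_left, symp_smul_right]; ring
  rw [h1, h2, norm_smul, Real.norm_of_nonneg hr]
  ring

lemma dH_triangle {n : ℕ} (x y z : Heis n) : dH x z ≤ dH x y + dH y z := by
  have : hmul (hinv x) z = hmul (hmul (hinv x) y) (hmul (hinv y) z) := by
    rw [hmul_assoc]
    congr 1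
    rw [← hmul_assoc]
    ext1
    · simp [hmul, hinv]
    · simp [hmul, hinv, symp_self, symp_neg_right]
      rw [show symp (0 : EuclideanSpace ℝ (Fin (2 * n))) z.1 = 0 by
        simpa using symp_smul_left 0 z.1 z.1]
  unfold dH
  rw [this]
  exact KNorm_hmul_le _ _

lemma norm_le_dH {n : ℕ} (x y : Heis n) : ‖y.1 - x.1‖ ≤ dH x y := by
  have := norm_le_KNorm (hmul (hinv x) y)
  rw [hinv_hmul] at this
  rw [dH, hinv_hmul]; exact this

lemma vert_le_dH {n : ℕ} (x y : Heis n) : |vert x (y - x)| ≤ dH x y ^ 2 := by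
  have := abs_le_KNorm_sq (hmul (hinv x) y)
  rw [hinv_hmul] at this
  rw [dH, hinv_hmul]; exact this

lemma dH_le_of {n : ℕ} {x y : Heis n} {a : ℝ} (ha : 0 ≤ a) (h1 : ‖y.1 - x.1‖ ≤ a)
    (h2 : |vert x (y - x)| ≤ a ^ 2) : dH x y ≤ 2 * a := by
  rw [dH, hinv_hmul]
  exact KNorm_le_of ha h1 h2

lemma norm_sub_le_dH {n : ℕ} (x y : Heis n) :
    ‖y - x‖ ≤ (1 + 2 * ‖x.1‖ + dH x y) * dH x y := by
  have h0 := dH_nonneg x y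
  have h1 := norm_le_dH x y
  have h2 := vert_le_dH x y
  have h3 := abs_symp_le x.1 (y.1 - x.1)
  have h4 : (y - x).2 = vert x (y - x) + symp x.1 (y.1 - x.1) := by simp [vert]
  have h5 := norm_nonneg x.1
  have h6 := mul_le_mul_of_nonneg_left h1 h5
  rw [Prod.norm_def, max_le_iff]
  constructor
  · simp only [Prod.fst_sub]; nlinarith [mul_nonneg h5 h0]
  · rw [h4, Real.norm_eq_abs]
    have := abs_add_le (vert x (y - x)) (symp x.1 (y.1 - x.1))
    nlinarith

lemma continuous_symp {n : ℕ} : Continuous fun p : EuclideanSpace ℝ (Fin (2 * n)) ×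
    EuclideanSpace ℝ (Fin (2 * n)) => symp p.1 p.2 := by
  unfold symp
  fun_prop

lemma continuous_dH {n : ℕ} : Continuous fun p : Heis n × Heis n => dH p.1 p.2 := by
  unfold dH KNorm
  simp only [hinv_hmul, vert]
  apply Continuous.rpow_const
  · apply Continuous.add
    · fun_prop
    · apply Continuous.pow
      apply Continuous.sub
      · fun_prop
      · have h : Continuous fun p : Heis n × Heis n => (p.1.1, (p.2 - p.1).1) := by fun_prop
        exact continuous_symp.comp h
  · intro x; right; norm_num

lemma continuous_dH_right {n : ℕ} (x : Heis n) : Continuous fun y => dH x y := by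
  have h : Continuous fun y : Heis n => (x, y) := Continuous.prodMk_right x
  have h2 := Continuous.comp (g := fun p : Heis n × Heis n => dH p.1 p.2)
    (f := fun y : Heis n => (x, y)) continuous_dH h
  simpa only [Function.comp_def] using h2

lemma dH_self {n : ℕ} (x : Heis n) : dH x x = 0 := by
  have : dH x x ^ 4 = 0 := by
    rw [dH_pow]; simp [vert, show symp x.1 (0 : EuclideanSpace ℝ (Fin (2 * n))) = 0 by
        simpa using symp_smul_right 0 x.1 x.1]
  exact pow_eq_zero_iff (by norm_num) |>.1 this

lemma isOpen_iff_dH {n : ℕ} (s : Set (Heis n)) :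
    IsOpen s ↔ ∀ x ∈ s, ∃ ε > 0, ∀ y, dH x y < ε → y ∈ s := by
  constructor
  · intro hs x hx
    obtain ⟨ρ, hρ, h⟩ := Metric.isOpen_iff.1 hs x hx
    have hpos : 0 < 2 + 2 * ‖x.1‖ := by positivity
    refine ⟨min 1 (ρ / (2 + 2 * ‖x.1‖)), by positivity, fun y hy => h ?_⟩
    rw [Metric.mem_ball, dist_eq_norm]
    have h1 := lt_of_lt_of_le hy (min_le_left _ _)
    have h2 := lt_of_lt_of_le hy (min_le_right _ _)
    rw [lt_div_iff₀ hpos] at h2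
    have := norm_sub_le_dH x y
    have h0 := dH_nonneg x y
    nlinarith
  · intro h
    rw [isOpen_iff_mem_nhds]
    intro x hx
    obtain ⟨ε, hε, h⟩ := h x hx
    have : ∀ᶠ y in nhds x, dH x y < ε := by
      apply (continuous_dH_right x).continuousAt.eventually_lt continuousAt_const
      rw [dH_self]; exact hε
    filter_upwards [this] with y hy using h y hy

/-- The Heisenberg group equipped with the Koranyi metric. -/
def HK (n : ℕ) := Heis n

instance (n : ℕ) : TopologicalSpace (HK n) := inferInstanceAs (TopologicalSpace (Heis n))
instance (n : ℕ) : MeasurableSpace (HK n) := inferInstanceAs (MeasurableSpace (Heis n))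
instance (n : ℕ) : BorelSpace (HK n) := inferInstanceAs (BorelSpace (Heis n))
instance (n : ℕ) : SecondCountableTopology (HK n) :=
  inferInstanceAs (SecondCountableTopology (Heis n))

instance instMetricHK (n : ℕ) : MetricSpace (HK n) :=
  MetricSpace.ofDistTopology (α := HK n) (fun x y => dH (n := n) x y) (fun x => dH_self (n := n) x)
    (fun x y => dH_comm (n := n) x y)
    (fun x y z => dH_triangle (n := n) x y z) (fun s => isOpen_iff_dH (n := n) s)
    (fun x y h => by
      have := norm_sub_le_dH (n := n) x y
      rw [show dH (n := n) x y = 0 from h] at this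
      simp only [mul_zero, norm_le_zero_iff] at this
      exact (sub_eq_zero.1 this).symm)

lemma dist_HK {n : ℕ} (x y : HK n) : dist x y = dH (n := n) x y := rfl

lemma isCompact_ballH {n : ℕ} (x : Heis n) (r : ℝ) : IsCompact (ballH x r) := by
  apply Metric.isCompact_of_isClosed_isBounded
  · exact isClosed_le (continuous_dH_right x) continuous_const
  · rw [Metric.isBounded_iff_subset_closedBall x]
    refine ⟨(1 + 2 * ‖x.1‖ + r) * r, fun y hy => ?_⟩
    have hy : dH x y ≤ r := hy
    rw [Metric.mem_closedBall, dist_eq_norm]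
    have := norm_sub_le_dH x y
    have h0 := dH_nonneg x y
    have h5 := norm_nonneg x.1
    nlinarith

lemma closedBall_HK {n : ℕ} (x : HK n) (r : ℝ) : Metric.closedBall x r = ballH (n := n) x r := by
  ext y
  rw [Metric.mem_closedBall, dist_comm]
  rfl

instance (n : ℕ) : ProperSpace (HK n) :=
  ⟨fun x r => by rw [closedBall_HK]; exact isCompact_ballH (n := n) x r⟩

lemma ediamH_eq {n : ℕ} (T : Set (HK n)) : ediamH (n := n) T = Metric.ediam T := by
  simp only [Metric.ediam, edist_dist, dist_HK]
  rfl

lemma hausH_eq {n : ℕ} (T : Set (HK n)) {s : ℝ} (hs : 0 < s) :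
    hausH (n := n) s T = μH[s] T := by
  rw [Measure.hausdorffMeasure_apply]
  have key : ∀ A : Set (HK n), ediamH (n := n) A ^ s = ⨆ _ : A.Nonempty, Metric.ediam A ^ s := by
    intro A
    rw [ediamH_eq]
    rcases A.eq_empty_or_nonempty with rfl | h
    · simp [hs]
    · simp [h]
  apply le_antisymm
  · refine iSup₂_le fun δ hδ => ?_
    refine le_trans ?_ (le_iSup₂ (ENNReal.ofReal δ) (ENNReal.ofReal_pos.2 hδ))
    refine le_iInf fun t => le_iInf fun ht => le_iInf fun ht2 => ?_
    refine (iInf_le _ t).trans ((iInf_le _ ht).trans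
      ((iInf_le _ (fun i => (ediamH_eq (t i)).le.trans (ht2 i))).trans ?_))
    exact ENNReal.tsum_le_tsum fun i => (key (t i)).le
  · refine iSup₂_le fun r hr => ?_
    obtain ⟨δ, hδ, hδr⟩ := ENNReal.lt_iff_exists_nnreal_btwn.1 hr
    have hδ' : (0:ℝ) < δ := by exact_mod_cast hδ
    refine le_trans ?_ (le_iSup₂ (δ : ℝ) hδ')
    refine le_iInf fun t => le_iInf fun ht => le_iInf fun ht2 => ?_
    refine (iInf_le _ t).trans ((iInf_le _ ht).trans
      ((iInf_le _ (fun i => ?_)).trans ?_))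
    · refine ((ediamH_eq (n := n) (t i)).ge.trans (ht2 i)).trans ?_
      rw [ENNReal.ofReal_coe_nnreal]
      exact hδr.le
    · exact ENNReal.tsum_le_tsum fun i => (key (t i)).ge

/-- the definition of `dimHH` agrees with the usual Hausdorff dimension -/
lemma dimHH_eq {n : ℕ} (T : Set (HK n)) : dimHH (n := n) T = dimH T := by
  rw [dimH_def]
  apply le_antisymm
  · refine iSup₂_le fun d hd => ?_
    rcases eq_or_lt_of_le (zero_le (a := d)) with h | h
    · rw [← h]; simp
    · rw [hausH_eq T (by exact_mod_cast h)] at hd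
      exact le_iSup₂ (f := fun (d : ℝ≥0) (_ : μH[d] T = ⊤) => (d : ℝ≥0∞)) d hd
  · refine iSup₂_le fun d hd => ?_
    rcases eq_or_lt_of_le (zero_le (a := d)) with h | h
    · rw [← h]; simp
    · rw [← hausH_eq T (by exact_mod_cast h)] at hd
      exact le_iSup₂ (f := fun (d : ℝ≥0) (_ : hausH (n := n) (d : ℝ) T = ⊤) => (d : ℝ≥0∞)) d hd


lemma nhds_basis_ballH {n : ℕ} (x : Heis n) :
    (nhds x).HasBasis (fun r : ℝ => 0 < r) (fun r => ballH x r) := by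
  have h := Metric.nhds_basis_closedBall (α := HK n) (x := x)
  refine Filter.HasBasis.congr h (fun _ => Iff.rfl) (fun r _ => closedBall_HK (n := n) x r)

lemma suppH_eq {n : ℕ} (μ : Measure (Heis n)) : suppH μ = μ.support := by
  ext x
  rw [(nhds_basis_ballH x).mem_measureSupport]
  rfl

lemma measure_ballH_lt_top {n : ℕ} (μ : Measure (Heis n)) [μ.Regular] (x : Heis n) (r : ℝ) :
    μ (ballH x r) < ∞ := (isCompact_ballH x r).measure_lt_top

lemma isClosed_suppH {n : ℕ} (μ : Measure (Heis n)) : IsClosed (suppH μ) := by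
  rw [suppH_eq]; exact Measure.isClosed_support

lemma measure_compl_suppH {n : ℕ} (μ : Measure (Heis n)) : μ (suppH μ)ᶜ = 0 := by
  rw [suppH_eq]; exact Measure.measure_compl_support

lemma nonempty_suppH {n : ℕ} (μ : Measure (Heis n)) (h : μ ≠ 0) : (suppH μ).Nonempty := by
  rw [suppH_eq]; exact Measure.nonempty_support h

/-- balls of radius `4 * r` are covered by boundedly many balls of radius `r` -/
lemma exists_cover {n : ℕ} : ∃ D : ℕ, ∀ (x : Heis n) (r : ℝ), 0 < r →
    ∃ t : Finset (Heis n), t.card ≤ D ∧ ballH x (4 * r) ⊆ ⋃ y ∈ t, ballH y r := by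
  obtain ⟨t, -, ht⟩ := (isCompact_ballH (eH : Heis n) 4).elim_nhds_subcover
    (fun y => ballH y 1) (fun y _ => (nhds_basis_ballH y).mem_of_mem one_pos)
  classical
  refine ⟨t.card, fun x r hr => ⟨t.image (fun y => hmul x (dil r y)), Finset.card_image_le, ?_⟩⟩
  intro z hz
  have hz : dH x z ≤ 4 * r := hz
  set w := dil r⁻¹ (hmul (hinv x) z) with hw
  have hzw : z = hmul x (dil r w) := by
    have h1 : dil r w = hmul (hinv x) z := by
      rw [hw]
      ext1
      · simp [dil, smul_smul, hr.ne']
      · simp [dil]; field_simp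
    rw [h1, hinv_hmul]
    ext1
    · simp [hmul]
    · simp [hmul, vert]
      ring
  have hx : x = hmul x (dil r eH) := by
    ext1
    · simp [hmul, dil, eH]
    · simp [hmul, dil, eH]
      simpa using symp_smul_right 0 x.1 x.1
  have h2 : dH eH w ≤ 4 := by
    have h3 : dH x z = r * dH eH w := by
      have h5 := dH_left x (dil r eH) (dil r w)
      rw [← hx, ← hzw, dH_dil hr.le] at h5
      exact h5
    rw [h3] at hz
    nlinarith
  have h4 := ht h2
  simp only [mem_iUnion] at h4 ⊢
  obtain ⟨y, hy, hyw⟩ := h4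
  refine ⟨hmul x (dil r y), Finset.mem_image_of_mem _ hy, ?_⟩
  have hyw : dH y w ≤ 1 := hyw
  change dH _ z ≤ r
  rw [hzw, dH_left, dH_dil hr.le]
  nlinarith




lemma real_hasSum_exp (x : ℝ) : HasSum (fun k : ℕ => x ^ k / (k.factorial : ℝ)) (Real.exp x) := by
  rw [Real.exp_eq_exp_ℝ]; exact NormedSpace.expSeries_div_hasSum_exp x

lemma real_pow_div_le_exp {x : ℝ} (hx : 0 ≤ x) (k : ℕ) :
    x ^ k / (k.factorial : ℝ) ≤ Real.exp x :=
  le_hasSum (real_hasSum_exp x) k (fun j _ => by positivity)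

/-- Laplace transforms are analytic -/
lemma analytic_laplace {Y : Type*} [MeasurableSpace Y] (ν : Measure Y) {V : Type*}
    [NormedAddCommGroup V] [NormedSpace ℝ V] (q : Y → V →L[ℝ] ℝ)
    (hq : AEStronglyMeasurable q ν)
    (hinteg : ∀ R : ℝ, Integrable (fun y => Real.exp (R * ‖q y‖)) ν) (c : V) :
    AnalyticAt ℝ (fun c => ∫ y, Real.exp (q y c) ∂ν) c := by
  let T : (k : ℕ) → (V →L[ℝ] ℝ) → ContinuousMultilinearMap ℝ (fun _ : Fin k => V) ℝ :=
    fun k l => ((k.factorial : ℝ))⁻¹ •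
      (ContinuousMultilinearMap.mkPiAlgebraFin ℝ k ℝ).compContinuousLinearMap (fun _ => l)
  have hTc : ∀ k, Continuous (T k) := by
    intro k
    have h := (ContinuousMultilinearMap.compContinuousLinearMapContinuousMultilinear ℝ
      (fun _ : Fin k => V) (fun _ : Fin k => ℝ) ℝ).cont
    have h2 : Continuous fun l : V →L[ℝ] ℝ => (fun _ : Fin k => l) := by fun_prop
    have h3 := (h.comp h2).clm_apply
      (continuous_const (y := ContinuousMultilinearMap.mkPiAlgebraFin ℝ k ℝ))
    exact h3.const_smul ((k.factorial : ℝ)⁻¹)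
  have hTn : ∀ k l, ‖T k l‖ ≤ ‖l‖ ^ k / (k.factorial : ℝ) := by
    intro k l
    have h := ContinuousMultilinearMap.norm_compContinuousLinearMap_le
      (ContinuousMultilinearMap.mkPiAlgebraFin ℝ k ℝ) (fun _ => l)
    simp only [ContinuousMultilinearMap.norm_mkPiAlgebraFin, one_mul, Finset.prod_const,
      Finset.card_univ, Fintype.card_fin] at h
    rw [norm_smul, div_eq_inv_mul]
    gcongr
    rw [Real.norm_of_nonneg (by positivity)]
  have hTa : ∀ k l (v : V), T k l (fun _ => v) = (l v) ^ k / (k.factorial : ℝ) := by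
    intro k l v
    simp [T, div_eq_inv_mul]
  have hTi : ∀ k, Integrable (fun y => T k (q y)) ν := by
    intro k
    refine (hinteg 1).mono ((hTc k).comp_aestronglyMeasurable hq) (ae_of_all _ fun y => ?_)
    refine (hTn k (q y)).trans ?_
    rw [Real.norm_of_nonneg (Real.exp_pos _).le, one_mul]
    exact real_pow_div_le_exp (norm_nonneg _) k
  let p : FormalMultilinearSeries ℝ V ℝ := fun k => ∫ y, T k (q y) ∂ν
  have hrad : p.radius = ∞ := by
    apply FormalMultilinearSeries.radius_eq_top_of_forall_nnreal_isBigO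
    intro r
    apply Asymptotics.IsBigO.of_bound (∫ y, Real.exp (r * ‖q y‖) ∂ν)
    refine Eventually.of_forall fun k => ?_
    rw [Real.norm_of_nonneg (by positivity), norm_one, mul_one]
    calc ‖p k‖ * (r : ℝ) ^ k ≤ (∫ y, ‖T k (q y)‖ ∂ν) * (r : ℝ) ^ k := by
          gcongr; exact norm_integral_le_integral_norm _
      _ = ∫ y, ‖T k (q y)‖ * (r : ℝ) ^ k ∂ν := (integral_mul_const _ _).symm
      _ ≤ _ := by
        apply integral_mono ((hTi k).norm.mul_const _) (hinteg r)
        intro y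
        refine le_trans ?_ (real_pow_div_le_exp (x := r * ‖q y‖) (by positivity) k)
        simp only
        rw [mul_pow]
        have := mul_le_mul_of_nonneg_right (hTn k (q y)) (pow_nonneg r.coe_nonneg k)
        refine this.trans (le_of_eq ?_)
        ring
  have hps : HasFPowerSeriesOnBall (fun c => ∫ y, Real.exp (q y c) ∂ν) p 0 ∞ := by
    refine ⟨hrad.ge, by simp, fun {v} _ => ?_⟩
    rw [zero_add]
    have h1 : ∀ k, (p k) (fun _ => v) = ∫ y, (q y v) ^ k / (k.factorial : ℝ) ∂ν := by
      intro k
      simp only [p]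
      rw [ContinuousMultilinearMap.integral_apply (hTi k)]
      simp only [hTa]
    simp only [h1]
    apply hasSum_integral_of_dominated_convergence
      (fun k y => (‖v‖ * ‖q y‖) ^ k / (k.factorial : ℝ))
    · intro k
      have := (hTi k).aestronglyMeasurable
      have h2 : Continuous fun m : ContinuousMultilinearMap ℝ (fun _ : Fin k => V) ℝ =>
        m (fun _ => v) := (ContinuousMultilinearMap.apply ℝ (fun _ : Fin k => V) ℝ _).continuous
      have h3 := h2.comp_aestronglyMeasurable this
      simpa only [hTa] using h3
    · intro k
      refine ae_of_all _ fun y => ?_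
      rw [norm_div, norm_pow, Real.norm_of_nonneg (by positivity : (0:ℝ) ≤ (k.factorial : ℝ))]
      gcongr
      rw [mul_comm]
      exact (q y).le_opNorm v
    · exact ae_of_all _ fun y => (real_hasSum_exp _).summable
    · simp only [(real_hasSum_exp _).tsum_eq]
      exact hinteg _
    · exact ae_of_all _ fun y => real_hasSum_exp _
  exact hps.analyticAt_of_mem (by simp)



lemma measure_ball_le_of_ud {n : ℕ} (μ : Measure (Heis n)) (hud : UniformlyDistributed μ)
    {x₀ : Heis n} (hx₀ : x₀ ∈ suppH μ) (y : Heis n) {r : ℝ} (hr : 0 < r) :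
    μ (ballH y r) ≤ μ (ballH x₀ (2 * r)) := by
  by_cases h : (ballH y r ∩ suppH μ).Nonempty
  · obtain ⟨z, hz, hzS⟩ := h
    rw [hud x₀ hx₀ z hzS (2 * r) (by positivity)]
    apply measure_mono
    intro w hw
    have h1 : dH y z ≤ r := hz
    have h2 : dH y w ≤ r := hw
    have h3 := dH_triangle z y w
    rw [dH_comm z y] at h3
    change dH z w ≤ 2 * r
    linarith
  · have : ballH y r ⊆ (suppH μ)ᶜ := by
      intro w hw hwS
      exact h ⟨w, hw, hwS⟩
    rw [measure_mono_null this (measure_compl_suppH μ)]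
    exact bot_le

lemma exists_growth {n : ℕ} (μ : Measure (Heis n)) (hud : UniformlyDistributed μ)
    {x₀ : Heis n} (hx₀ : x₀ ∈ suppH μ) : ∃ D : ℕ, 1 ≤ D ∧ ∀ j : ℕ,
    μ (ballH x₀ (2 ^ (j + 1))) ≤ (D : ℝ≥0∞) ^ j * μ (ballH x₀ 2) := by
  obtain ⟨D, hD⟩ := exists_cover (n := n)
  refine ⟨D + 1, by omega, fun j => ?_⟩
  induction j with
  | zero => simp
  | succ j ih =>
    obtain ⟨t, htc, ht⟩ := hD x₀ (2 ^ j) (by positivity)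
    rw [show (4 : ℝ) * 2 ^ j = 2 ^ (j + 1 + 1) by ring] at ht
    calc μ (ballH x₀ (2 ^ (j + 1 + 1))) ≤ μ (⋃ y ∈ t, ballH y (2 ^ j)) := measure_mono ht
      _ ≤ ∑ y ∈ t, μ (ballH y (2 ^ j)) := measure_biUnion_finset_le _ _
      _ ≤ ∑ y ∈ t, μ (ballH x₀ (2 ^ (j + 1))) := by
          apply Finset.sum_le_sum
          intro y _
          have := measure_ball_le_of_ud μ hud hx₀ y (r := 2 ^ j) (by positivity)
          rwa [show (2 : ℝ) * 2 ^ j = 2 ^ (j + 1) by ring] at this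
      _ = t.card * μ (ballH x₀ (2 ^ (j + 1))) := by simp
      _ ≤ ((D + 1 : ℕ) : ℝ≥0∞) * (((D + 1 : ℕ) : ℝ≥0∞) ^ j * μ (ballH x₀ 2)) := by
          gcongr
          omega
      _ = _ := by rw [pow_succ' _ j, mul_assoc]

lemma exp_bound_dyadic {c : ℝ} (hc : 0 < c) {D : ℕ} (hD : 1 ≤ D) :
    ∃ C : ℝ≥0, ∀ j : ℕ, Real.exp (-c * (2 ^ j) ^ 4) * D ^ j ≤ C * (1 / 2) ^ j := by
  obtain ⟨K, hK⟩ := pow_unbounded_of_one_lt (2 * D : ℝ) (by norm_num : (1 : ℝ) < 16)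
  refine ⟨⟨K.factorial / c ^ K, by positivity⟩, fun j => ?_⟩
  have h1 := real_pow_div_le_exp (x := c * (2 ^ j) ^ 4) (by positivity) K
  have hpos : 0 < (c * (2 ^ j) ^ 4) ^ K / (K.factorial : ℝ) := by positivity
  have h2 : Real.exp (-c * (2 ^ j) ^ 4) ≤ K.factorial / (c ^ K * (16 ^ K) ^ j) := by
    rw [neg_mul, Real.exp_neg]
    refine (inv_anti₀ hpos h1).trans (le_of_eq ?_)
    rw [inv_div, mul_pow]
    congr 2
    rw [← pow_mul, ← pow_mul, ← pow_mul, show (16 : ℝ) = 2 ^ 4 by norm_num, ← pow_mul]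
    congr 1
    ring
  have hD0 : (0 : ℝ) < D := by exact_mod_cast hD
  have h3 : (2 * D : ℝ) ^ j ≤ (16 ^ K) ^ j := pow_le_pow_left₀ (by positivity) hK.le j
  calc Real.exp (-c * (2 ^ j) ^ 4) * D ^ j ≤ K.factorial / (c ^ K * (2 * D) ^ j) * D ^ j := by
        refine mul_le_mul_of_nonneg_right (h2.trans ?_) (by positivity)
        gcongr
    _ = _ := by
      change _ = (K.factorial / c ^ K : ℝ) * (1 / 2) ^ j
      simp only [mul_pow, one_div, inv_pow]
      field_simp

lemma lintegral_exp_lt_top {n : ℕ} (μ : Measure (Heis n)) [μ.Regular]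
    (hud : UniformlyDistributed μ)
    {x₀ : Heis n} (hx₀ : x₀ ∈ suppH μ) {c : ℝ} (hc : 0 < c) :
    ∫⁻ y, ENNReal.ofReal (Real.exp (-c * dH x₀ y ^ 4)) ∂μ < ∞ := by
  obtain ⟨D, hD, hg⟩ := exists_growth μ hud hx₀
  obtain ⟨C, hC⟩ := exp_bound_dyadic hc hD
  have hmeas : ∀ r, MeasurableSet (ballH x₀ r) := fun r => (isCompact_ballH x₀ r).measurableSet
  have hpt : ∀ y, ENNReal.ofReal (Real.exp (-c * dH x₀ y ^ 4)) ≤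
      (ballH x₀ 2).indicator 1 y + ∑' j : ℕ, ENNReal.ofReal (Real.exp (-c * (2 ^ j) ^ 4)) *
        (ballH x₀ (2 ^ (j + 1))).indicator 1 y := by
    intro y
    rcases le_or_gt (dH x₀ y) 1 with h | h
    · have : y ∈ ballH x₀ 2 := by change dH x₀ y ≤ 2; linarith
      rw [indicator_of_mem this]
      refine le_trans ?_ le_self_add
      rw [Pi.one_apply, ← ENNReal.ofReal_one]
      apply ENNReal.ofReal_le_ofReal
      rw [Real.exp_le_one_iff]
      have : 0 ≤ dH x₀ y ^ 4 := by have := dH_nonneg x₀ y; positivity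
      nlinarith
    · obtain ⟨j, hj1, hj2⟩ := exists_nat_pow_near h.le (by norm_num : (1 : ℝ) < 2)
      refine le_trans ?_ le_add_self
      refine le_trans ?_ (ENNReal.le_tsum j)
      have : y ∈ ballH x₀ (2 ^ (j + 1)) := hj2.le
      rw [indicator_of_mem this]
      simp only [Pi.one_apply, mul_one]
      apply ENNReal.ofReal_le_ofReal
      apply Real.exp_le_exp.2
      have := pow_le_pow_left₀ (by positivity) hj1 4
      nlinarith
  refine (lintegral_mono hpt).trans_lt ?_
  rw [lintegral_add_left (measurable_one.indicator (hmeas 2)), lintegral_indicator_one (hmeas 2)]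
  refine ENNReal.add_lt_top.2 ⟨measure_ballH_lt_top _ _ _, ?_⟩
  rw [lintegral_tsum (fun j => ((measurable_one.indicator (hmeas _)).const_mul _).aemeasurable)]
  have : ∀ j : ℕ, ∫⁻ y, ENNReal.ofReal (Real.exp (-c * (2 ^ j) ^ 4)) *
        (ballH x₀ (2 ^ (j + 1))).indicator 1 y ∂μ ≤
        C * μ (ballH x₀ 2) * (ENNReal.ofReal (1 / 2)) ^ j := by
    intro j
    rw [lintegral_const_mul _ (measurable_one.indicator (hmeas _)),
      lintegral_indicator_one (hmeas _)]
    calc _ ≤ ENNReal.ofReal (Real.exp (-c * (2 ^ j) ^ 4)) *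
          ((D : ℝ≥0∞) ^ j * μ (ballH x₀ 2)) := by gcongr; exact hg j
      _ = ENNReal.ofReal (Real.exp (-c * (2 ^ j) ^ 4) * D ^ j) * μ (ballH x₀ 2) := by
          rw [ENNReal.ofReal_mul (by positivity), ENNReal.ofReal_pow (by positivity),
            ENNReal.ofReal_natCast, mul_assoc]
      _ ≤ ENNReal.ofReal (C * (1 / 2) ^ j) * μ (ballH x₀ 2) := 
          mul_le_mul' (ENNReal.ofReal_le_ofReal (hC j)) le_rfl
      _ = _ := by
          rw [ENNReal.ofReal_mul (by positivity), ENNReal.ofReal_pow (by positivity),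
            ENNReal.ofReal_coe_nnreal]
          ring
  refine (ENNReal.tsum_le_tsum this).trans_lt ?_
  rw [ENNReal.tsum_mul_left, ENNReal.tsum_geometric]
  refine ENNReal.mul_lt_top (ENNReal.mul_lt_top (by simp) (measure_ballH_lt_top _ _ _)) ?_
  rw [ENNReal.inv_lt_top, tsub_pos_iff_lt]
  rw [← ENNReal.ofReal_one]
  exact (ENNReal.ofReal_lt_ofReal_iff one_pos).2 (by norm_num)



/-- separated functions of growth at most `d` in the second variable -/
def SepF {n : ℕ} (d : ℕ) (f : Heis n → Heis n → ℝ) : Prop :=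
  ∃ (ι : Type) (_ : Fintype ι) (m : ι → Heis n → ℝ) (q : ι → Heis n → ℝ),
    (∀ i x, AnalyticAt ℝ (m i) x) ∧ (∀ i, Continuous (q i)) ∧
    (∃ C : ℝ, 0 ≤ C ∧ ∀ i y, |q i y| ≤ C * (1 + KNorm y) ^ d) ∧
    ∀ x y, f x y = ∑ i, m i x * q i y

lemma SepF.mono {n a b : ℕ} {f : Heis n → Heis n → ℝ} (hf : SepF a f) (h : a ≤ b) : SepF b f := by
  obtain ⟨ι, _, m, q, h1, h2, ⟨C, hC, h3⟩, h4⟩ := hf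
  refine ⟨ι, inferInstance, m, q, h1, h2, ⟨C, hC, fun i y => (h3 i y).trans ?_⟩, h4⟩
  gcongr
  have := KNorm_nonneg y
  linarith

lemma SepF.add {n d : ℕ} {f g : Heis n → Heis n → ℝ} (hf : SepF d f) (hg : SepF d g) :
    SepF d (fun x y => f x y + g x y) := by
  obtain ⟨ι, _, m, q, h1, h2, ⟨C, hC, h3⟩, h4⟩ := hf
  obtain ⟨ι', _, m', q', h1', h2', ⟨C', hC', h3'⟩, h4'⟩ := hg
  refine ⟨ι ⊕ ι', inferInstance, Sum.elim m m', Sum.elim q q', ?_, ?_,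
    ⟨C + C', by positivity, ?_⟩, ?_⟩
  · rintro (i | i) x
    · exact h1 i x
    · exact h1' i x
  · rintro (i | i)
    · exact h2 i
    · exact h2' i
  · rintro (i | i) y
    · refine (h3 i y).trans ?_
      have := KNorm_nonneg y
      gcongr; linarith
    · refine (h3' i y).trans ?_
      have := KNorm_nonneg y
      gcongr; linarith
  · intro x y
    simp [h4, h4']

lemma SepF.mul {n a b : ℕ} {f g : Heis n → Heis n → ℝ} (hf : SepF a f) (hg : SepF b g) :
    SepF (a + b) (fun x y => f x y * g x y) := by
  obtain ⟨ι, _, m, q, h1, h2, ⟨C, hC, h3⟩, h4⟩ := hf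
  obtain ⟨ι', _, m', q', h1', h2', ⟨C', hC', h3'⟩, h4'⟩ := hg
  refine ⟨ι × ι', inferInstance, fun i x => m i.1 x * m' i.2 x, fun i y => q i.1 y * q' i.2 y,
    ?_, ?_, ⟨C * C', by positivity, ?_⟩, ?_⟩
  · exact fun i x => (h1 _ x).mul (h1' _ x)
  · exact fun i => (h2 _).mul (h2' _)
  · intro i y
    rw [abs_mul, pow_add]
    have := KNorm_nonneg y
    calc _ ≤ (C * (1 + KNorm y) ^ a) * (C' * (1 + KNorm y) ^ b) :=
          mul_le_mul (h3 _ y) (h3' _ y) (abs_nonneg _) (by positivity)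
      _ = _ := by ring
  · intro x y
    simp only [h4, h4', Fintype.sum_mul_sum, Fintype.sum_prod_type]
    refine Finset.sum_congr rfl fun i _ => Finset.sum_congr rfl fun j _ => ?_
    ring

lemma SepF.left {n : ℕ} {m : Heis n → ℝ} (hm : ∀ x, AnalyticAt ℝ m x) : SepF 0 (fun x _ => m x) :=
  ⟨Unit, inferInstance, fun _ => m, fun _ _ => 1, fun _ => hm, fun _ => continuous_const,
    ⟨1, zero_le_one, by simp⟩, by simp⟩

lemma SepF.right {n d : ℕ} {q : Heis n → ℝ} (hq : Continuous q) (C : ℝ) (hC : 0 ≤ C)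
    (h : ∀ y, |q y| ≤ C * (1 + KNorm y) ^ d) : SepF d (fun _ y => q y) :=
  ⟨Unit, inferInstance, fun _ _ => 1, fun _ => q, fun _ _ => analyticAt_const, fun _ => hq,
    ⟨C, hC, fun _ => h⟩, by simp⟩

lemma SepF.sum {n d : ℕ} {κ : Type} (s : Finset κ) {f : κ → Heis n → Heis n → ℝ}
    (hf : ∀ k, SepF d (f k)) : SepF d (fun x y => ∑ k ∈ s, f k x y) := by
  classical
  induction s using Finset.induction_on with
  | empty =>
    simpa using (SepF.left (n := n) (m := fun _ => 0) (fun _ => analyticAt_const)).mono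
      (Nat.zero_le d)
  | insert a s ha ih => simpa only [Finset.sum_insert ha] using (hf a).add ih

lemma SepF.const_mul {n d : ℕ} {f : Heis n → Heis n → ℝ} (hf : SepF d f) (c : ℝ) :
    SepF d (fun x y => c * f x y) := by
  have := (SepF.left (n := n) (m := fun _ => c) (fun _ => analyticAt_const)).mul hf
  rwa [zero_add] at this

lemma abs_coord_le {n : ℕ} (i : Fin (2 * n)) (y : Heis n) : |y.1 i| ≤ KNorm y := by
  have := PiLp.norm_apply_le y.1 i
  exact this.trans (norm_le_KNorm y)

lemma analyticAt_coord {n : ℕ} (i : Fin (2 * n)) (x : Heis n) :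
    AnalyticAt ℝ (fun x : Heis n => x.1 i) x :=
  (((EuclideanSpace.proj i : EuclideanSpace ℝ (Fin (2 * n)) →L[ℝ] ℝ).comp
    (ContinuousLinearMap.fst ℝ _ ℝ)).analyticAt x)

lemma sep_coord {n : ℕ} (i j : Fin (2 * n)) : SepF 1 (fun x y : Heis n => x.1 i * y.1 j) := by
  have h1 := SepF.left (n := n) (analyticAt_coord i)
  have h2 : SepF 1 (fun _ y : Heis n => y.1 j) := SepF.right (by fun_prop) 1 zero_le_one (fun y => by
    have := abs_coord_le j y
    linarith)
  exact h1.mul h2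

lemma sep_inner {n : ℕ} : SepF 1 (fun x y : Heis n => (inner ℝ x.1 y.1 : ℝ)) := by
  have := SepF.sum (n := n) Finset.univ (fun i : Fin (2 * n) => sep_coord i i)
  convert this using 3
  rw [PiLp.inner_apply]
  refine Finset.sum_congr rfl fun i _ => ?_
  simp [mul_comm]

lemma sep_symp {n : ℕ} : SepF 1 (fun x y : Heis n => symp x.1 y.1) := by
  unfold symp
  apply SepF.const_mul
  apply SepF.sum
  intro j
  simp only [sub_eq_add_neg]
  refine (sep_coord _ _).add ?_
  simpa using (sep_coord _ _).const_mul (-1)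

lemma exists_sep {n : ℕ} : ∃ g : Heis n → Heis n → ℝ, SepF 3 g ∧
    ∀ x y, dH x y ^ 4 = KNorm y ^ 4 + g x y := by
  have hX : SepF 0 (fun x _ : Heis n => ‖x.1‖ ^ 2) := by
    apply SepF.left
    intro x
    have : (fun x : Heis n => ‖x.1‖ ^ 2) = fun x : Heis n => ∑ i, x.1 i * x.1 i := by
      ext x
      rw [EuclideanSpace.real_norm_sq_eq]
      simp only [sq]
    rw [this]
    apply Finset.analyticAt_fun_sum
    intro i _
    exact (analyticAt_coord i x).mul (analyticAt_coord i x)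
  have hP : SepF 2 (fun _ y : Heis n => ‖y.1‖ ^ 2) := SepF.right (by fun_prop) 1 zero_le_one
    (fun y => by
      have := norm_le_KNorm y
      rw [abs_of_nonneg (by positivity), one_mul]
      have h0 := norm_nonneg y.1
      gcongr; linarith)
  have hx2 : SepF 0 (fun x _ : Heis n => x.2) := SepF.left fun x =>
    (ContinuousLinearMap.snd ℝ (EuclideanSpace ℝ (Fin (2 * n))) ℝ).analyticAt x
  have hy2 : SepF 2 (fun _ y : Heis n => y.2) := SepF.right (by fun_prop) 1 zero_le_one
    (fun y => by
      have := abs_le_KNorm_sq y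
      rw [one_mul]
      have h0 := KNorm_nonneg y
      nlinarith)
  have hI := sep_inner (n := n)
  have hs := sep_symp (n := n)
  refine ⟨_, (((((((((((hX.mul hX).mono (by norm_num : 0 + 0 ≤ 3)).add
    (((hI.mul hI).const_mul 4).mono (by norm_num))).add
    (((hP.mul hX).const_mul 2).mono (by norm_num))).add
    (((hP.mul hI).const_mul (-4)).mono (by norm_num))).add
    (((hX.mul hI).const_mul (-4)).mono (by norm_num))).add
    ((hx2.mul hx2).mono (by norm_num))).add
    ((hs.mul hs).mono (by norm_num))).add
    (((hy2.mul hx2).const_mul (-2)).mono (by norm_num))).add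
    (((hy2.mul hs).const_mul (-2)).mono (by norm_num))).add
    (((hx2.mul hs).const_mul 2).mono (by norm_num))), fun x y => ?_⟩
  rw [dH_pow, KNorm_pow]
  have h1 : ‖y.1 - x.1‖ ^ 2 = ‖y.1‖ ^ 2 - 2 * inner ℝ y.1 x.1 + ‖x.1‖ ^ 2 := norm_sub_sq_real _ _
  have h2 : ‖y.1 - x.1‖ ^ 4 = (‖y.1‖ ^ 2 - 2 * inner ℝ y.1 x.1 + ‖x.1‖ ^ 2) ^ 2 := by
    rw [← h1]; ring
  rw [h2, real_inner_comm]
  simp only [vert, Prod.snd_sub, Prod.fst_sub, symp_sub_right, symp_self]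
  ring



lemma cubic_le_quartic {A s : ℝ} (hA : 0 ≤ A) (hs : 0 < s) :
    ∃ C : ℝ, ∀ K : ℝ, 0 ≤ K → A * (1 + K) ^ 3 ≤ s * K ^ 4 + C := by
  refine ⟨8 * A + 8 * A * (8 * A / s) ^ 3, fun K hK => ?_⟩
  have h1 : (1 + K) ^ 3 ≤ 8 * (1 + K ^ 3) := by
    nlinarith [mul_nonneg hK (sq_nonneg (K - 1)), sq_nonneg (K - 1), pow_nonneg hK 3]
  have h2 : 8 * A * K ^ 3 ≤ s * K ^ 4 + 8 * A * (8 * A / s) ^ 3 := by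
    rcases le_total K (8 * A / s) with h | h
    · have := pow_le_pow_left₀ hK h 3
      have h3 : 0 ≤ s * K ^ 4 := by positivity
      nlinarith
    · rw [div_le_iff₀ hs] at h
      have := mul_le_mul_of_nonneg_right h (pow_nonneg hK 3)
      have h3 : 0 ≤ 8 * A * (8 * A / s) ^ 3 := by positivity
      nlinarith
  nlinarith

lemma dH_pow_le {n : ℕ} (x y z : Heis n) : dH x z ^ 4 ≤ 8 * (dH x y ^ 4 + dH y z ^ 4) := by
  have h := pow_le_pow_left₀ (dH_nonneg x z) (dH_triangle x y z) 4
  refine h.trans ?_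
  have h1 : (dH x y + dH y z) ^ 2 ≤ 2 * (dH x y ^ 2 + dH y z ^ 2) := by
    nlinarith [sq_nonneg (dH x y - dH y z)]
  have h2 := pow_le_pow_left₀ (sq_nonneg _) h1 2
  nlinarith [sq_nonneg (dH x y ^ 2 - dH y z ^ 2)]

lemma continuous_expd {n : ℕ} (x : Heis n) (s : ℝ) :
    Continuous fun y => Real.exp (-s * dH x y ^ 4) :=
  Real.continuous_exp.comp (continuous_const.mul ((continuous_dH_right x).pow 4))

lemma integrable_expd {n : ℕ} (μ : Measure (Heis n)) [μ.Regular] (hμ : μ ≠ 0)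
    (hud : UniformlyDistributed μ) (x : Heis n) {s : ℝ} (hs : 0 < s) :
    Integrable (fun y => Real.exp (-s * dH x y ^ 4)) μ := by
  obtain ⟨x₀, hx₀⟩ := nonempty_suppH μ hμ
  have h0 : Integrable (fun y => Real.exp (-(s / 8) * dH x₀ y ^ 4)) μ := by
    refine ⟨(continuous_expd x₀ (s / 8)).aestronglyMeasurable, ?_⟩
    rw [hasFiniteIntegral_iff_ofReal (ae_of_all _ fun y => (Real.exp_pos _).le)]
    exact lintegral_exp_lt_top μ hud hx₀ (by positivity)
  refine (h0.const_mul (Real.exp (s * dH x₀ x ^ 4))).mono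
    (continuous_expd x s).aestronglyMeasurable (ae_of_all _ fun y => ?_)
  rw [Real.norm_of_nonneg (Real.exp_pos _).le, Real.norm_of_nonneg (by positivity), ← Real.exp_add]
  apply Real.exp_le_exp.2
  have := dH_pow_le x₀ x y
  nlinarith

lemma KNorm_eq_dH {n : ℕ} (y : Heis n) : dH eH y = KNorm y := by
  have h : hmul (hinv eH) y = y := by
    ext1
    · simp [hmul, hinv, eH]
    · simp only [hmul, hinv, eH, neg_zero, zero_add]
      simpa using symp_smul_left 0 y.1 y.1
  rw [dH, h]

/-- the Gaussian-type integrals of `μ` -/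
def gInt {n : ℕ} (μ : Measure (Heis n)) (s : ℝ) (x : Heis n) : ℝ :=
  ∫ y, Real.exp (-s * dH x y ^ 4) ∂μ

lemma analyticAt_gInt {n : ℕ} (μ : Measure (Heis n)) [μ.Regular] (hμ : μ ≠ 0)
    (hud : UniformlyDistributed μ) {s : ℝ} (hs : 0 < s) (x : Heis n) :
    AnalyticAt ℝ (gInt μ s) x := by
  obtain ⟨g, ⟨ι, _, m, q, h1, h2, ⟨C, hC, h3⟩, h4⟩, hg⟩ := exists_sep (n := n)
  have hKc : Continuous fun y : Heis n => KNorm y := by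
    have := continuous_dH_right (eH : Heis n)
    simpa only [KNorm_eq_dH] using this
  have hwc : Continuous fun y : Heis n => Real.exp (-s * KNorm y ^ 4) := by
    have := continuous_expd (eH : Heis n) s
    simpa only [KNorm_eq_dH] using this
  let w : Heis n → ℝ≥0∞ := fun y => ENNReal.ofReal (Real.exp (-s * KNorm y ^ 4))
  have hw : Measurable w := ENNReal.measurable_ofReal.comp hwc.measurable
  have hwt : ∀ y, (w y).toReal = Real.exp (-s * KNorm y ^ 4) := fun y =>
    ENNReal.toReal_ofReal (Real.exp_pos _).le
  let Q : Heis n → (ι → ℝ) →L[ℝ] ℝ := fun y =>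
    ∑ i, (-s * q i y) • (ContinuousLinearMap.proj i : (ι → ℝ) →L[ℝ] ℝ)
  have hQc : Continuous Q := by
    refine continuous_finset_sum _ fun i _ => ?_
    exact (continuous_const.mul (h2 i)).smul continuous_const
  have hQn : ∃ C' : ℝ, 0 ≤ C' ∧ ∀ y, ‖Q y‖ ≤ C' * (1 + KNorm y) ^ 3 := by
    refine ⟨∑ i : ι, s * C * ‖(ContinuousLinearMap.proj i : (ι → ℝ) →L[ℝ] ℝ)‖,
      Finset.sum_nonneg fun i _ => by positivity, fun y => ?_⟩
    refine (norm_sum_le _ _).trans ?_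
    rw [Finset.sum_mul]
    refine Finset.sum_le_sum fun i _ => ?_
    rw [norm_smul, Real.norm_eq_abs, abs_mul, abs_neg, abs_of_pos hs]
    have := mul_le_mul_of_nonneg_left (h3 i y) hs.le
    have := mul_le_mul_of_nonneg_right this
      (norm_nonneg (ContinuousLinearMap.proj i : (ι → ℝ) →L[ℝ] ℝ))
    refine this.trans (le_of_eq ?_)
    ring
  obtain ⟨C', hC', hQn⟩ := hQn
  have hinteg : ∀ R : ℝ, Integrable (fun y => Real.exp (R * ‖Q y‖)) (μ.withDensity w) := by
    intro R
    rw [integrable_withDensity_iff hw (ae_of_all _ fun y => ENNReal.ofReal_lt_top)]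
    simp only [hwt]
    obtain ⟨B, hB⟩ := cubic_le_quartic (A := |R| * C') (by positivity) (half_pos hs)
    have hi := integrable_expd μ hμ hud eH (half_pos hs)
    simp only [KNorm_eq_dH] at hi
    refine (hi.const_mul (Real.exp B)).mono ?_ (ae_of_all _ fun y => ?_)
    · exact ((Real.continuous_exp.comp (continuous_const.mul hQc.norm)).mul hwc).aestronglyMeasurable
    · rw [Real.norm_of_nonneg (by positivity), Real.norm_of_nonneg (by positivity),
        ← Real.exp_add, ← Real.exp_add]
      apply Real.exp_le_exp.2
      have h5 := hB (KNorm y) (KNorm_nonneg y)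
      have h6 : R * ‖Q y‖ ≤ |R| * (C' * (1 + KNorm y) ^ 3) :=
        mul_le_mul (le_abs_self R) (hQn y) (norm_nonneg _) (abs_nonneg _)
      nlinarith
  have hA := analytic_laplace (μ.withDensity w) Q hQc.aestronglyMeasurable hinteg
  have hm : AnalyticAt ℝ (fun x i => m i x) x := AnalyticAt.pi fun i => h1 i x
  have hcomp := (hA (fun i => m i x)).comp hm
  convert hcomp using 1
  ext z
  simp only [gInt, Function.comp_def]
  rw [integral_withDensity_eq_integral_toReal_smul hw (ae_of_all _ fun y => ENNReal.ofReal_lt_top)]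
  congr 1
  ext y
  rw [hwt, smul_eq_mul, ← Real.exp_add, hg, h4]
  congr 1
  simp only [Q, ContinuousLinearMap.sum_apply, ContinuousLinearMap.smul_apply,
    ContinuousLinearMap.proj_apply, smul_eq_mul, mul_add, Finset.mul_sum]
  congr 1
  refine Finset.sum_congr rfl fun i _ => ?_
  ring

lemma gInt_eq_of_mem {n : ℕ} (μ : Measure (Heis n)) [μ.Regular]
    (hud : UniformlyDistributed μ) {s : ℝ} (hs : 0 < s) {x x₀ : Heis n} (hx : x ∈ suppH μ)
    (hx₀ : x₀ ∈ suppH μ) : gInt μ s x = gInt μ s x₀ := by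
  have key : ∀ z : Heis n, gInt μ s z = (∫⁻ t in Ioi (0 : ℝ),
      μ {y | t ≤ Real.exp (-s * dH z y ^ 4)}).toReal := by
    intro z
    rw [gInt, integral_eq_lintegral_of_nonneg_ae (ae_of_all _ fun y => (Real.exp_pos _).le)
      (continuous_expd z s).aestronglyMeasurable]
    rw [lintegral_eq_lintegral_meas_le μ (ae_of_all _ fun y => (Real.exp_pos _).le)
      (continuous_expd z s).aemeasurable]
  rw [key, key]
  congr 1
  have hne : ∀ᵐ t : ℝ ∂(volume.restrict (Ioi 0)), t ≠ 1 := by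
    apply ae_restrict_of_ae
    exact Measure.ae_ne volume 1
  apply lintegral_congr_ae
  filter_upwards [hne, ae_restrict_mem measurableSet_Ioi] with t ht1 ht0
  have ht0 : 0 < t := ht0
  rcases lt_or_gt_of_ne ht1 with h | h
  · set r : ℝ := (-Real.log t / s) ^ ((1 : ℝ) / 4) with hr
    have hlog := Real.log_neg ht0 h
    have hpos : 0 < -Real.log t / s := div_pos (by linarith) hs
    have hr0 : 0 < r := Real.rpow_pos_of_pos hpos _
    have hr4 : r ^ 4 = -Real.log t / s := by
      rw [hr, ← Real.rpow_natCast, ← Real.rpow_mul hpos.le]; norm_num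
    have hball : ∀ z : Heis n, {y | t ≤ Real.exp (-s * dH z y ^ 4)} = ballH z r := by
      intro z
      ext y
      change t ≤ _ ↔ dH z y ≤ r
      rw [← pow_le_pow_iff_left₀ (dH_nonneg z y) hr0.le (by norm_num : 4 ≠ 0), hr4,
        ← Real.log_le_iff_le_exp ht0, le_div_iff₀ hs]
      constructor <;> intro h <;> linarith
    rw [hball, hball]
    exact hud x hx x₀ hx₀ r hr0
  · have hemp : ∀ z : Heis n, {y | t ≤ Real.exp (-s * dH z y ^ 4)} = ∅ := by
      intro z
      ext y
      simp only [mem_setOf_eq, mem_empty_iff_false, iff_false, not_le]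
      refine lt_of_le_of_lt (Real.exp_le_one_iff.2 ?_) h
      have : 0 ≤ dH z y ^ 4 := pow_nonneg (dH_nonneg z y) 4
      nlinarith
    rw [hemp, hemp]

lemma exists_gInt_ne {n : ℕ} (μ : Measure (Heis n)) [μ.Regular] (hμ : μ ≠ 0)
    (hud : UniformlyDistributed μ) {x x₀ : Heis n} (hx : x ∉ suppH μ)
    (hx₀ : x₀ ∈ suppH μ) : ∃ s : ℝ, 0 < s ∧ gInt μ s x ≠ gInt μ s x₀ := by
  have hx' : ∃ ε : ℝ, 0 < ε ∧ μ (ballH x ε) = 0 := by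
    simp only [suppH, mem_setOf_eq, not_forall, not_lt] at hx
    obtain ⟨ε, hε, h⟩ := hx
    exact ⟨ε, hε, le_antisymm h bot_le⟩
  obtain ⟨ε, hε, hε0⟩ := hx'
  set η := ε / 2 with hη
  have hη0 : 0 < η := by positivity
  set b := μ.real (ballH x₀ η) with hb
  have hb0 : 0 < b := ENNReal.toReal_pos (hx₀ η hη0).ne' (measure_ballH_lt_top _ _ _).ne
  have hlow : ∀ s : ℝ, 0 < s → Real.exp (-s * η ^ 4) * b ≤ gInt μ s x₀ := by
    intro s hs
    have hm : MeasurableSet (ballH x₀ η) := (isCompact_ballH _ _).measurableSet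
    have h1 := setIntegral_le_integral (s := ballH x₀ η) (integrable_expd μ hμ hud x₀ hs)
      (ae_of_all _ fun y => (Real.exp_pos _).le)
    refine le_trans ?_ h1
    have h2 : ∫ y in ballH x₀ η, Real.exp (-s * η ^ 4) ∂μ = Real.exp (-s * η ^ 4) * b := by
      rw [setIntegral_const, smul_eq_mul, mul_comm]
    rw [← h2]
    apply setIntegral_mono_on
    · exact integrableOn_const (measure_ballH_lt_top _ _ _).ne
    · exact (integrable_expd μ hμ hud x₀ hs).integrableOn
    · exact hm
    · intro y hy
      apply Real.exp_le_exp.2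
      have := pow_le_pow_left₀ (dH_nonneg _ _) (show dH x₀ y ≤ η from hy) 4
      nlinarith
  have hup : ∀ s : ℝ, 1 < s → gInt μ s x ≤ Real.exp (-(s - 1) * ε ^ 4) * gInt μ 1 x := by
    intro s hs
    rw [gInt, gInt, ← integral_const_mul]
    apply integral_mono_ae (integrable_expd μ hμ hud x (by linarith))
      ((integrable_expd μ hμ hud x one_pos).const_mul _)
    have : ∀ᵐ y ∂μ, y ∉ ballH x ε := measure_eq_zero_iff_ae_notMem.1 hε0
    filter_upwards [this] with y hy
    rw [← Real.exp_add]
    apply Real.exp_le_exp.2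
    have hy : ε < dH x y := not_le.1 hy
    have := pow_le_pow_left₀ hε.le hy.le 4
    nlinarith
  set c := gInt μ 1 x with hc
  have htend : Tendsto (fun s : ℝ => Real.exp (-s * (ε ^ 4 - η ^ 4)) * (Real.exp (ε ^ 4) * c))
      atTop (nhds 0) := by
    have hpos : 0 < ε ^ 4 - η ^ 4 := by
      have := pow_lt_pow_left₀ (show η < ε by rw [hη]; linarith) hη0.le (n := 4) (by norm_num)
      linarith
    have h1 : Tendsto (fun s : ℝ => s * (ε ^ 4 - η ^ 4)) atTop atTop :=
      tendsto_id.atTop_mul_const hpos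
    have h2 := (Real.tendsto_exp_neg_atTop_nhds_zero.comp h1).mul_const (Real.exp (ε ^ 4) * c)
    rw [zero_mul] at h2
    refine h2.congr fun s => ?_
    simp
  obtain ⟨s, hs1, hs2⟩ := ((htend.eventually_lt_const hb0).and (eventually_gt_atTop 1)).exists
  refine ⟨s, by linarith, fun heq => ?_⟩
  have h1 := hlow s (by linarith)
  have h2 := hup s hs2
  rw [← heq] at h1
  have h3 := h1.trans h2
  have h4 : b ≤ Real.exp (-s * (ε ^ 4 - η ^ 4)) * (Real.exp (ε ^ 4) * c) := by
    have h5 := mul_le_mul_of_nonneg_left h3 (Real.exp_pos (s * η ^ 4)).le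
    rw [← mul_assoc, ← mul_assoc, ← Real.exp_add, ← Real.exp_add] at h5
    rw [← mul_assoc, ← Real.exp_add]
    rw [show s * η ^ 4 + -s * η ^ 4 = 0 by ring, Real.exp_zero, one_mul] at h5
    refine h5.trans (le_of_eq ?_)
    congr 2
    ring
  linarith

theorem analytic_part (n : ℕ) (μ : Measure (Heis n)) [μ.Regular] (hμ : μ ≠ 0)
    (hud : UniformlyDistributed μ) :
    ∃ F : ℝ → Heis n → ℝ, (∀ s : ℝ, 0 < s → ∀ x : Heis n, AnalyticAt ℝ (F s) x) ∧
      suppH μ = ⋂ (s : ℝ) (_ : 0 < s), {x : Heis n | F s x = 0} := by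
  obtain ⟨x₀, hx₀⟩ := nonempty_suppH μ hμ
  refine ⟨fun s x => gInt μ s x - gInt μ s x₀, fun s hs x =>
    (analyticAt_gInt μ hμ hud hs x).sub analyticAt_const, ?_⟩
  ext x
  simp only [mem_iInter, mem_setOf_eq, sub_eq_zero]
  constructor
  · intro hx s hs
    exact gInt_eq_of_mem μ hud hs hx hx₀
  · intro h
    by_contra hx
    obtain ⟨s, hs, hne⟩ := exists_gInt_ne μ hμ hud hx hx₀
    exact hne (h s hs)



lemma dimH_le_of_covers {X : Type*} [MetricSpace X] [MeasurableSpace X] [BorelSpace X]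
    (A : Set X) (k : ℕ) (K C : ℝ) (hC : 0 ≤ C)
    (h : ∀ N : ℕ, 1 ≤ N → ∃ T : Finset X, (T.card : ℝ) ≤ K * N ^ k ∧
      A ⊆ ⋃ y ∈ T, Metric.closedBall y (C / N)) : dimH A ≤ k := by
  choose! T hT1 hT2 using h
  have hfin : μH[(k : ℝ≥0)] A ≠ ∞ := by
    have := Measure.hausdorffMeasure_le_liminf_sum (X := X) (β := ℕ) (ι := fun N => T (N + 1))
      ((k : ℝ≥0) : ℝ) A (l := atTop) (fun N => ENNReal.ofReal (2 * C * (1 / ((N : ℝ) + 1))))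
      (by
        have h1 := (tendsto_one_div_add_atTop_nhds_zero_nat (𝕜 := ℝ)).const_mul (2 * C)
        rw [mul_zero] at h1
        have h2 := ENNReal.tendsto_ofReal h1
        rwa [ENNReal.ofReal_zero] at h2)
      (fun N y => Metric.closedBall (y : X) (C / ((N + 1 : ℕ) : ℝ)))
      (Eventually.of_forall fun N y => by
        refine Metric.ediam_le fun a ha b hb => ?_
        rw [edist_dist]
        apply ENNReal.ofReal_le_ofReal
        have := dist_triangle_right a b (y : X)
        have h1 := Metric.mem_closedBall.1 ha
        have h2 := Metric.mem_closedBall.1 hb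
        push_cast at h1 h2
        rw [← div_eq_mul_one_div]
        have h3 : 2 * C / ((N : ℝ) + 1) = C / ((N : ℝ) + 1) + C / ((N : ℝ) + 1) := by ring
        linarith)
      (Eventually.of_forall fun N => by
        refine (hT2 (N + 1) (by omega)).trans ?_
        intro z hz
        simp only [mem_iUnion] at hz ⊢
        obtain ⟨y, hy, hz⟩ := hz
        exact ⟨⟨y, hy⟩, hz⟩)
    refine (lt_of_le_of_lt this ?_).ne
    refine lt_of_le_of_lt (b := ENNReal.ofReal (K * (2 * C) ^ k)) ?_ ENNReal.ofReal_lt_top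
    refine Filter.liminf_le_of_frequently_le' (Eventually.frequently (Eventually.of_forall fun N => ?_))
    have hd : ∀ y : T (N + 1), Metric.ediam (Metric.closedBall (y : X) (C / ((N + 1 : ℕ) : ℝ))) ^
        ((k : ℝ≥0) : ℝ) ≤ ENNReal.ofReal ((2 * C / ((N : ℝ) + 1)) ^ k) := by
      intro y
      rw [ENNReal.ofReal_pow (by positivity)]
      rw [NNReal.coe_natCast, ENNReal.rpow_natCast]
      gcongr
      refine Metric.ediam_le fun a ha b hb => ?_
      rw [edist_dist]
      apply ENNReal.ofReal_le_ofReal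
      have := dist_triangle_right a b (y : X)
      have h1 := Metric.mem_closedBall.1 ha
      have h2 := Metric.mem_closedBall.1 hb
      push_cast at h1 h2
      have h3 : 2 * C / ((N : ℝ) + 1) = C / ((N : ℝ) + 1) + C / ((N : ℝ) + 1) := by ring
      linarith
    refine (Finset.sum_le_sum fun y _ => hd y).trans ?_
    rw [Finset.sum_const, nsmul_eq_mul, Finset.card_univ, Fintype.card_coe,
      ← ENNReal.ofReal_natCast, ← ENNReal.ofReal_mul (by positivity)]
    apply ENNReal.ofReal_le_ofReal
    have h1 := hT1 (N + 1) (by omega)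
    push_cast at h1
    have hN : (0 : ℝ) < (N : ℝ) + 1 := by positivity
    calc _ ≤ K * ((N : ℝ) + 1) ^ k * (2 * C / ((N : ℝ) + 1)) ^ k :=
          mul_le_mul_of_nonneg_right h1 (by positivity)
      _ = _ := by rw [div_pow]; field_simp
  have := dimH_le_of_hausdorffMeasure_ne_top hfin
  simpa using this

lemma dimH_le_of_uniform {X : Type*} [MetricSpace X] [ProperSpace X] [MeasurableSpace X]
    [BorelSpace X] (μ : Measure X) [IsFiniteMeasureOnCompacts μ] (S : Set X) (hSc : IsClosed S)
    (hS0 : μ Sᶜ = 0)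
    (hpos : ∀ x ∈ S, ∀ r : ℝ, 0 < r → 0 < μ (Metric.closedBall x r))
    (hud : ∀ x ∈ S, ∀ y ∈ S, ∀ r : ℝ, 0 < r →
      μ (Metric.closedBall x r) = μ (Metric.closedBall y r))
    (p : X) (hp : p ∈ S) (ρ : ℝ) (hρ : 0 < ρ) (k : ℕ) (C : ℝ) (hC : 0 < C)
    (hcov : ∀ N : ℕ, 1 ≤ N → ∃ (ι : Type) (_ : Fintype ι) (t : ι → Set X),
      (Fintype.card ι : ℝ) ≤ C * N ^ k ∧ (∀ i, ∀ x ∈ t i, ∀ y ∈ t i, dist x y ≤ C / N) ∧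
      S ∩ Metric.closedBall p ρ ⊆ ⋃ i, t i) : dimH S ≤ k := by
  have hfin : ∀ x r, μ (Metric.closedBall x r) < ∞ := fun x r =>
    (isCompact_closedBall x r).measure_lt_top
  set a := μ.real (Metric.closedBall p ρ) with ha
  have ha0 : 0 < a := ENNReal.toReal_pos (hpos p hp ρ hρ).ne' (hfin _ _).ne
  have hlow : ∀ N : ℕ, 1 ≤ N → a ≤ C * N ^ k * μ.real (Metric.closedBall p (C / N)) := by
    intro N hN
    have hN0 : (0 : ℝ) < N := by exact_mod_cast hN
    obtain ⟨ι, _, t, h1, h2, h3⟩ := hcov N hN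
    have h4 : μ (Metric.closedBall p ρ) ≤ (Fintype.card ι) * μ (Metric.closedBall p (C / N)) := by
      calc μ (Metric.closedBall p ρ) ≤ μ ((⋃ i, (t i ∩ S)) ∪ Sᶜ) := by
            apply measure_mono
            intro x hx
            by_cases hxS : x ∈ S
            · left
              obtain ⟨i, hi⟩ := mem_iUnion.1 (h3 ⟨hxS, hx⟩)
              exact mem_iUnion.2 ⟨i, hi, hxS⟩
            · right; exact hxS
        _ ≤ μ (⋃ i, (t i ∩ S)) + μ Sᶜ := measure_union_le _ _
        _ = μ (⋃ i, (t i ∩ S)) := by rw [hS0, add_zero]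
        _ ≤ ∑ i, μ (t i ∩ S) := by
            have := measure_iUnion_le (μ := μ) (fun i => t i ∩ S)
            rwa [tsum_fintype] at this
        _ ≤ ∑ i : ι, μ (Metric.closedBall p (C / N)) := by
            apply Finset.sum_le_sum
            intro i _
            rcases (t i ∩ S).eq_empty_or_nonempty with h | ⟨x, hx, hxS⟩
            · rw [h]; simp
            · rw [hud p hp x hxS _ (by positivity)]
              apply measure_mono
              intro y hy
              exact Metric.mem_closedBall.2 (h2 i y hy.1 x hx)
        _ = _ := by simp
    have h5 := ENNReal.toReal_mono (ENNReal.mul_lt_top (by simp) (hfin _ _)).ne h4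
    rw [ENNReal.toReal_mul, ENNReal.toReal_natCast] at h5
    refine le_trans h5 ?_
    exact mul_le_mul_of_nonneg_right h1 ENNReal.toReal_nonneg
  have hR : ∀ R : ℕ, dimH (S ∩ Metric.closedBall p R) ≤ k := by
    intro R
    set A := S ∩ Metric.closedBall p R with hA
    have hAc : IsCompact A := (isCompact_closedBall p R).inter_left hSc
    set M := μ.real (Metric.closedBall p (R + C)) with hM
    have hM0 : 0 ≤ M := ENNReal.toReal_nonneg
    refine dimH_le_of_covers A k (M * C / a) (2 * C) (by positivity) ?_
    intro N hN
    have hN0 : (0 : ℝ) < N := by exact_mod_cast hN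
    set r : ℝ := C / N with hr
    have hr0 : 0 < r := by positivity
    have hrC : r ≤ C := div_le_self hC.le (by exact_mod_cast hN)
    let r' : ℝ≥0 := ⟨r, hr0.le⟩
    have hpk : Metric.packingNumber (2 * r') A ≠ ⊤ := by
      obtain ⟨T, hTA, hTf, hT⟩ := Metric.exists_finite_isCover_of_isCompact (ε := r')
        (by intro h; exact hr0.ne' (congrArg NNReal.toReal h)) hAc
      have h1 := Metric.packingNumber_two_mul_le_externalCoveringNumber r' A
      have h2 := hT.externalCoveringNumber_le_encard
      have h3 := h1.trans h2
      intro h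
      rw [h, top_le_iff] at h3
      exact (hTf.encard_lt_top).ne h3
    set T := Metric.maximalSeparatedSet (2 * r') A with hT
    have hTA : T ⊆ A := Metric.maximalSeparatedSet_subset
    have hTs : Metric.IsSeparated (2 * r' : ℝ≥0) T := Metric.isSeparated_maximalSeparatedSet
    have hTc := Metric.isCover_maximalSeparatedSet hpk
    have hTf : T.Finite := by
      rw [← Set.encard_lt_top_iff, hT, Metric.encard_maximalSeparatedSet hpk]
      exact lt_top_iff_ne_top.2 hpk
    refine ⟨hTf.toFinset, ?_, ?_⟩
    · have hdisj : (hTf.toFinset : Set X).PairwiseDisjoint fun x => Metric.closedBall x r := by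
        intro x hx y hy hxy
        have hx : x ∈ T := by simpa using hx
        have hy : y ∈ T := by simpa using hy
        apply Metric.closedBall_disjoint_closedBall
        have h1 : ((2 * r' : ℝ≥0) : ℝ≥0∞) < edist x y := hTs hx hy hxy
        rw [edist_dist] at h1
        have h2 := (ENNReal.lt_ofReal_iff_toReal_lt ENNReal.coe_ne_top).1 h1
        simp only [ENNReal.coe_toReal, NNReal.coe_mul] at h2
        change (2 : ℝ) * r < _ at h2
        linarith
      have h1 : ∑ x ∈ hTf.toFinset, μ (Metric.closedBall x r) ≤ μ (Metric.closedBall p (R + C)) := by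
        rw [← measure_biUnion_finset hdisj (fun x _ => Metric.isClosed_closedBall.measurableSet)]
        apply measure_mono
        intro z hz
        simp only [mem_iUnion] at hz
        obtain ⟨x, hx, hz⟩ := hz
        have hx : x ∈ T := by simpa using hx
        have h2 := Metric.mem_closedBall.1 (hTA hx).2
        have h3 := Metric.mem_closedBall.1 hz
        have := dist_triangle z x p
        exact Metric.mem_closedBall.2 (by linarith)
      have h2 : (hTf.toFinset.card : ℝ≥0∞) * μ (Metric.closedBall p r) ≤
          μ (Metric.closedBall p (R + C)) := by
        refine le_trans (le_of_eq ?_) h1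
        rw [← nsmul_eq_mul, ← Finset.sum_const]
        refine Finset.sum_congr rfl fun x hx => ?_
        have hx : x ∈ T := by simpa using hx
        exact hud p hp x (hTA hx).1 r hr0
      have h3 := ENNReal.toReal_mono (hfin _ _).ne h2
      rw [ENNReal.toReal_mul, ENNReal.toReal_natCast] at h3
      change (hTf.toFinset.card : ℝ) * μ.real (Metric.closedBall p r) ≤ M at h3
      have h4 := hlow N hN
      rw [← hr] at h4
      rw [div_mul_eq_mul_div, le_div_iff₀ ha0]
      have h5 := mul_le_mul_of_nonneg_left h4 (Nat.cast_nonneg (α := ℝ) hTf.toFinset.card)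
      have h6 := mul_le_mul_of_nonneg_left h3 (show 0 ≤ C * (N : ℝ) ^ k by positivity)
      nlinarith
    · have := Metric.isCover_iff_subset_iUnion_closedBall.1 hTc
      refine this.trans ?_
      intro z hz
      simp only [mem_iUnion] at hz ⊢
      obtain ⟨y, hy, hz⟩ := hz
      refine ⟨y, by simpa using hy, ?_⟩
      have h7 : ((2 * r' : ℝ≥0) : ℝ) = 2 * C / N := by
        rw [NNReal.coe_mul]; change 2 * r = _; rw [hr]; ring
      rwa [h7] at hz
  have hU : S = ⋃ R : ℕ, (S ∩ Metric.closedBall p R) := by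
    rw [← inter_iUnion, Metric.iUnion_closedBall_nat, inter_univ]
  rw [hU, dimH_iUnion]
  exact iSup_le hR



lemma le_dimH_of_mass {X W : Type*} [MetricSpace X] [MeasurableSpace X] [BorelSpace X]
    [TopologicalSpace W] [MeasurableSpace W] [OpensMeasurableSpace W]
    (lam : Measure W) (G : Set W) (hG : MeasurableSet G) (hG0 : lam G ≠ 0)
    (f : W → X) (hf : ContinuousOn f G) (S : Set X) (hfS : f '' G ⊆ S) (k : ℕ) (hk : 0 < k)
    (C : ℝ) (hC : 0 < C)
    (h : ∀ v ∈ G, ∀ r : ℝ, 0 ≤ r → r ≤ 1 →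
      lam {u ∈ G | dist (f v) (f u) ≤ r} ≤ ENNReal.ofReal (C * r ^ k)) :
    (k : ℝ≥0∞) ≤ dimH S := by
  have hfm : AEMeasurable f (lam.restrict G) := hf.aemeasurable hG
  set ν := Measure.map f (lam.restrict G) with hν
  have hνs : ∀ s : Set X, Metric.ediam s ≤ 1 → ν s ≤ ENNReal.ofReal C * Metric.ediam s ^ k := by
    intro s hs
    refine (measure_mono subset_closure).trans ?_
    rw [← Metric.ediam_closure] at hs ⊢
    rw [hν, Measure.map_apply_of_aemeasurable hfm isClosed_closure.measurableSet,
      Measure.restrict_apply' hG]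
    rcases (f ⁻¹' closure s ∩ G).eq_empty_or_nonempty with h0 | ⟨v, hv, hvG⟩
    · rw [h0]; simp
    · have hne : Metric.ediam (closure s) ≠ ∞ := (lt_of_le_of_lt hs one_lt_top).ne
      set r := (Metric.ediam (closure s)).toReal with hr
      have hr1 : r ≤ 1 := by
        have := ENNReal.toReal_mono one_ne_top hs
        rwa [ENNReal.toReal_one] at this
      have h1 := h v hvG r ENNReal.toReal_nonneg hr1
      have h2 : ENNReal.ofReal (C * r ^ k) = ENNReal.ofReal C * Metric.ediam (closure s) ^ k := by
        rw [ENNReal.ofReal_mul hC.le, ENNReal.ofReal_pow ENNReal.toReal_nonneg,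
          ENNReal.ofReal_toReal hne]
      rw [← h2]
      refine (measure_mono ?_).trans h1
      rintro u ⟨hu, huG⟩
      refine ⟨huG, ?_⟩
      have h3 := Metric.edist_le_ediam_of_mem (s := closure s) (x := f v) (y := f u) hv hu
      have h4 := ENNReal.toReal_mono hne h3
      rwa [edist_dist, ENNReal.toReal_ofReal dist_nonneg] at h4
  have hCr : ENNReal.ofReal C ≠ 0 := (ENNReal.ofReal_pos.2 hC).ne'
  have hle : (ENNReal.ofReal C)⁻¹ • ν ≤ μH[((k : ℝ≥0) : ℝ)] := by
    apply Measure.le_hausdorffMeasure _ _ 1 one_pos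
    intro s hs
    rw [Measure.smul_apply, smul_eq_mul]
    calc _ ≤ (ENNReal.ofReal C)⁻¹ * (ENNReal.ofReal C * Metric.ediam s ^ k) := by
          gcongr; exact hνs s hs
      _ = Metric.ediam s ^ k := by
          rw [← mul_assoc, ENNReal.inv_mul_cancel hCr ENNReal.ofReal_ne_top, one_mul]
      _ ≤ _ := by rw [NNReal.coe_natCast, ENNReal.rpow_natCast]
  have hνS : 0 < ν S := by
    refine lt_of_lt_of_le (pos_iff_ne_zero.2 hG0) ?_
    refine le_trans ?_ (Measure.le_map_apply hfm S)
    rw [Measure.restrict_apply' hG]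
    apply measure_mono
    intro u hu
    exact ⟨hfS ⟨u, hu, rfl⟩, hu⟩
  have hH : μH[((k : ℝ≥0) : ℝ)] S ≠ 0 := by
    have h1 := hle S
    rw [Measure.smul_apply, smul_eq_mul] at h1
    intro h0
    rw [h0] at h1
    have h2 := mul_eq_zero.1 (le_antisymm h1 bot_le)
    rcases h2 with h2 | h2
    · exact ENNReal.ofReal_ne_top (ENNReal.inv_eq_zero.1 h2)
    · exact hνS.ne' h2
  have := le_dimH_of_hausdorffMeasure_ne_zero hH
  simpa using this

lemma cube_cover {m : ℕ} (w0 : Fin m → ℝ) {ε : ℝ} (hε : 0 < ε) (N : ℕ) (hN : 1 ≤ N) :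
    ∃ Q : (Fin m → Fin (N + 1)) → Set (Fin m → ℝ),
      (∀ a, Q a ⊆ Metric.closedBall w0 ε) ∧
      (∀ a, ∀ u ∈ Q a, ∀ v ∈ Q a, dist u v ≤ 2 * ε / N) ∧
      Metric.closedBall w0 ε ⊆ ⋃ a, Q a := by
  have hN0 : (0 : ℝ) < N := by exact_mod_cast hN
  refine ⟨fun a => {u | u ∈ Metric.closedBall w0 ε ∧
    ∀ i, ⌊(u i - w0 i + ε) * (N / (2 * ε))⌋₊ = a i}, fun a u hu => hu.1, ?_, ?_⟩
  · rintro a u ⟨hu, hua⟩ v ⟨hv, hva⟩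
    rw [dist_pi_le_iff (by positivity)]
    intro i
    have hu0 : 0 ≤ (u i - w0 i + ε) * (N / (2 * ε)) := by
      have := (dist_le_pi_dist u w0 i).trans hu
      rw [Real.dist_eq, abs_le] at this
      exact mul_nonneg (by linarith) (by positivity)
    have hv0 : 0 ≤ (v i - w0 i + ε) * (N / (2 * ε)) := by
      have := (dist_le_pi_dist v w0 i).trans hv
      rw [Real.dist_eq, abs_le] at this
      exact mul_nonneg (by linarith) (by positivity)
    have h1 := Nat.floor_le hu0
    have h2 := Nat.lt_floor_add_one ((u i - w0 i + ε) * (N / (2 * ε)))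
    have h3 := Nat.floor_le hv0
    have h4 := Nat.lt_floor_add_one ((v i - w0 i + ε) * (N / (2 * ε)))
    rw [hua i] at h1 h2
    rw [hva i] at h3 h4
    have h5 : |(u i - v i) * (N / (2 * ε))| ≤ 1 := by
      rw [abs_le]; constructor <;> nlinarith
    rw [abs_mul, abs_of_pos (by positivity : 0 < (N : ℝ) / (2 * ε))] at h5
    rw [Real.dist_eq, le_div_iff₀ hN0]
    rw [← mul_div_assoc, div_le_one (by positivity)] at h5
    exact h5
  · intro u hu
    rw [mem_iUnion]
    have hb : ∀ i, ⌊(u i - w0 i + ε) * (N / (2 * ε))⌋₊ < N + 1 := by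
      intro i
      have := (dist_le_pi_dist u w0 i).trans hu
      rw [Real.dist_eq, abs_le] at this
      rw [Nat.lt_succ_iff]
      apply Nat.floor_le_of_le
      calc _ ≤ (2 * ε) * (N / (2 * ε)) := by
            apply mul_le_mul_of_nonneg_right (by linarith) (by positivity)
        _ = N := by field_simp
    exact ⟨fun i => ⟨_, hb i⟩, hu, fun i => rfl⟩



lemma vert_add {n : ℕ} (q v w : Heis n) : vert q (v + w) = vert q v + vert q w := by
  simp only [vert, Prod.snd_add, Prod.fst_add, symp_add_right]; ring

lemma vert_smul {n : ℕ} (q : Heis n) (c : ℝ) (v : Heis n) : vert q (c • v) = c * vert q v := by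
  simp only [vert, Prod.smul_snd, Prod.smul_fst, symp_smul_right, smul_eq_mul]; ring

/-- `vert q` as a continuous linear map. -/
def vertL {n : ℕ} (q : Heis n) : Heis n →L[ℝ] ℝ :=
  LinearMap.toContinuousLinearMap
    { toFun := vert q
      map_add' := vert_add q
      map_smul' := fun c v => by simp [vert_smul] }

lemma vertL_apply {n : ℕ} (q v : Heis n) : vertL q v = vert q v := rfl

lemma vert_sub {n : ℕ} (q v w : Heis n) : vert q (v - w) = vert q v - vert q w := by
  rw [← vertL_apply, map_sub]; rfl

lemma vert_change {n : ℕ} (p q v : Heis n) : vert q v = vert p v - symp (q.1 - p.1) v.1 := by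
  simp only [vert, symp_sub_left]; ring

lemma abs_vert_change {n : ℕ} (p q v : Heis n) :
    |vert q v - vert p v| ≤ 2 * (‖q - p‖ * ‖v‖) := by
  rw [vert_change p q v]
  have h := abs_symp_le (q.1 - p.1) v.1
  have h1 : ‖q.1 - p.1‖ ≤ ‖q - p‖ := norm_fst_le (q - p)
  have h2 : ‖v.1‖ ≤ ‖v‖ := norm_fst_le v
  rw [show vert p v - symp (q.1 - p.1) v.1 - vert p v = - symp (q.1 - p.1) v.1 by ring, abs_neg]
  refine h.trans ?_
  gcongr

lemma exists_local {m : ℕ} {E : Type*} [NormedAddCommGroup E] [NormedSpace ℝ E]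
    (B : Set (Fin m → ℝ)) (hB : IsOpen B) (φ : (Fin m → ℝ) → E)
    (hφ : ∀ w ∈ B, ContDiffAt ℝ (⊤ : WithTop ℕ∞) φ w) (w0 : Fin m → ℝ) (hw0 : w0 ∈ B) :
    ∃ ε K : ℝ, 0 < ε ∧ 0 < K ∧ Metric.closedBall w0 ε ⊆ B ∧
      (∀ w ∈ Metric.closedBall w0 ε, DifferentiableAt ℝ φ w) ∧
      (∀ w ∈ Metric.closedBall w0 ε, ‖fderiv ℝ φ w‖ ≤ K) ∧
      (∀ u ∈ Metric.closedBall w0 ε, ∀ v ∈ Metric.closedBall w0 ε, ‖φ v - φ u‖ ≤ K * ‖v - u‖) := by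
  have hd : ∀ w ∈ B, DifferentiableAt ℝ φ w := fun w hw => (hφ w hw).differentiableAt (by simp)
  have hc : ContinuousAt (fderiv ℝ φ) w0 :=
    ((hφ w0 hw0).fderiv_right (m := 0) (by simp)).continuousAt
  set K := ‖fderiv ℝ φ w0‖ + 1 with hK
  have hK0 : 0 < K := by positivity
  have h1 : ∀ᶠ w in nhds w0, ‖fderiv ℝ φ w‖ < K := hc.norm.eventually_lt_const (by rw [hK]; linarith)
  have h2 : ∀ᶠ w in nhds w0, w ∈ B := hB.mem_nhds hw0
  obtain ⟨ε, hε, h3⟩ := Metric.nhds_basis_closedBall.eventually_iff.1 (h1.and h2)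
  refine ⟨ε, K, hε, hK0, fun w hw => (h3 hw).2, fun w hw => hd w (h3 hw).2,
    fun w hw => (h3 hw).1.le, ?_⟩
  intro u hu v hv
  exact (convex_closedBall w0 ε).norm_image_sub_le_of_norm_fderiv_le
    (fun w hw => hd w (h3 hw).2) (fun w hw => (h3 hw).1.le) hu hv

lemma exists_localize {n m : ℕ} (S : Set (Heis n)) (B : Set (Fin m → ℝ)) (U : Set (Heis n))
    (hU : IsOpen U) (φ : (Fin m → ℝ) → Heis n) (π : Heis n →L[ℝ] (Fin m → ℝ))
    (hπ : ∀ w ∈ B, π (φ w) = w) (hS : S ∩ U = φ '' B) (w0 : Fin m → ℝ) (hw0 : w0 ∈ B)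
    (ε : ℝ) (hε : 0 < ε) :
    ∃ ρ : ℝ, 0 < ρ ∧ S ∩ ballH (φ w0) ρ ⊆ φ '' Metric.closedBall w0 ε := by
  have hU0 : φ w0 ∈ U := by
    have : φ w0 ∈ S ∩ U := hS ▸ ⟨w0, hw0, rfl⟩
    exact this.2
  have h1 : U ∩ π ⁻¹' Metric.ball w0 ε ∈ nhds (φ w0) := by
    refine (hU.inter (Metric.isOpen_ball.preimage π.continuous)).mem_nhds ⟨hU0, ?_⟩
    rw [mem_preimage, hπ w0 hw0]; exact Metric.mem_ball_self hε
  obtain ⟨ρ, hρ, h2⟩ := (nhds_basis_ballH (φ w0)).mem_iff.1 h1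
  refine ⟨ρ, hρ, ?_⟩
  rintro x ⟨hxS, hx⟩
  have h3 := h2 hx
  have h4 : x ∈ φ '' B := hS ▸ ⟨hxS, h3.1⟩
  obtain ⟨w, hw, rfl⟩ := h4
  refine ⟨w, ?_, rfl⟩
  have h5 := h3.2
  rw [mem_preimage, hπ w hw] at h5
  exact Metric.ball_subset_closedBall h5

/-- Horizontal case: the chart is Lipschitz into the Koranyi metric. -/
lemma horizontal_bound {n m : ℕ} (φ : (Fin m → ℝ) → Heis n) (w0 : Fin m → ℝ) (ε K : ℝ)
    (hK : 0 < K) (hd : ∀ w ∈ Metric.closedBall w0 ε, DifferentiableAt ℝ φ w)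
    (hdK : ∀ w ∈ Metric.closedBall w0 ε, ‖fderiv ℝ φ w‖ ≤ K)
    (hL : ∀ u ∈ Metric.closedBall w0 ε, ∀ v ∈ Metric.closedBall w0 ε, ‖φ v - φ u‖ ≤ K * ‖v - u‖)
    (hh : ∀ w ∈ Metric.closedBall w0 ε, ∀ v, vert (φ w) (fderiv ℝ φ w v) = 0)
    (u v : Fin m → ℝ) (hu : u ∈ Metric.closedBall w0 ε) (hv : v ∈ Metric.closedBall w0 ε) :
    dH (φ u) (φ v) ≤ 4 * K * ‖v - u‖ := by
  have hseg : segment ℝ u v ⊆ Metric.closedBall w0 ε :=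
    (convex_closedBall w0 ε).segment_subset hu hv
  have h1 : ‖vertL (φ u) (φ v) - vertL (φ u) (φ u)‖ ≤ (2 * K ^ 2 * ‖v - u‖) * ‖v - u‖ := by
    refine (convex_segment u v).norm_image_sub_le_of_norm_hasFDerivWithin_le
      (f := fun w => vertL (φ u) (φ w)) (f' := fun w => (vertL (φ u)).comp (fderiv ℝ φ w))
      (fun w hw => ((vertL (φ u)).hasFDerivAt.comp w (hd w (hseg hw)).hasFDerivAt).hasFDerivWithinAt)
      (fun w hw => ?_) (left_mem_segment ℝ u v) (right_mem_segment ℝ u v)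
    refine ContinuousLinearMap.opNorm_le_bound _ (by positivity) (fun z => ?_)
    have h2 := abs_vert_change (φ w) (φ u) (fderiv ℝ φ w z)
    rw [hh w (hseg hw) z, sub_zero] at h2
    have h3 : ‖φ u - φ w‖ ≤ K * ‖v - u‖ := by
      refine (hL w (hseg hw) u hu).trans ?_
      gcongr
      obtain ⟨t, ht, rfl⟩ := (segment_eq_image' ℝ u v ▸ hw)
      rw [show u - (u + t • (v - u)) = (-t) • (v - u) by module, norm_smul, norm_neg,
        Real.norm_of_nonneg ht.1]
      exact mul_le_of_le_one_left (norm_nonneg _) ht.2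
    have h4 : ‖fderiv ℝ φ w z‖ ≤ K * ‖z‖ :=
      (ContinuousLinearMap.le_opNorm _ _).trans (by gcongr; exact hdK w (hseg hw))
    show |vert (φ u) (fderiv ℝ φ w z)| ≤ _
    calc _ ≤ 2 * (‖φ u - φ w‖ * ‖fderiv ℝ φ w z‖) := h2
      _ ≤ 2 * ((K * ‖v - u‖) * (K * ‖z‖)) := by gcongr
      _ = _ := by ring
  rw [← map_sub, vertL_apply, Real.norm_eq_abs] at h1
  have h5 : ‖(φ v).1 - (φ u).1‖ ≤ 2 * K * ‖v - u‖ := by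
    refine (norm_fst_le (φ v - φ u)).trans ((hL u hu v hv).trans ?_)
    have := mul_nonneg hK.le (norm_nonneg (v - u)); linarith
  have := dH_le_of (x := φ u) (y := φ v) (a := 2 * K * ‖v - u‖) (by positivity) h5
    (h1.trans (by nlinarith [sq_nonneg (K * ‖v - u‖)]))
  linarith



lemma cov_horizontal {n m : ℕ} (φ : (Fin m → ℝ) → Heis n) (w0 : Fin m → ℝ) (ε L : ℝ)
    (hε : 0 < ε) (hL : 0 < L)
    (h : ∀ u ∈ Metric.closedBall w0 ε, ∀ v ∈ Metric.closedBall w0 ε,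
      dH (φ u) (φ v) ≤ L * ‖v - u‖) :
    ∃ C : ℝ, 0 < C ∧ ∀ N : ℕ, 1 ≤ N → ∃ (ι : Type) (_ : Fintype ι) (t : ι → Set (HK n)),
      (Fintype.card ι : ℝ) ≤ C * N ^ m ∧ (∀ i, ∀ x ∈ t i, ∀ y ∈ t i, dist x y ≤ C / N) ∧
      φ '' Metric.closedBall w0 ε ⊆ ⋃ i, t i := by
  refine ⟨2 ^ m + L * (2 * ε), by positivity, fun N hN => ?_⟩
  have hN0 : (1 : ℝ) ≤ N := by exact_mod_cast hN
  obtain ⟨Q, hQ1, hQ2, hQ3⟩ := cube_cover w0 hε N hN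
  refine ⟨Fin m → Fin (N + 1), inferInstance, fun a => φ '' Q a, ?_, ?_, ?_⟩
  · simp only [Fintype.card_pi, Fintype.card_fin, Finset.prod_const, Finset.card_univ]
    push_cast
    calc ((N : ℝ) + 1) ^ m ≤ (2 * N) ^ m := by gcongr; linarith
      _ = 2 ^ m * N ^ m := by rw [mul_pow]
      _ ≤ _ := by gcongr; nlinarith
  · rintro a _ ⟨u, hu, rfl⟩ _ ⟨v, hv, rfl⟩
    show dH (φ u) (φ v) ≤ _
    have h1 := hQ2 a v hv u hu
    rw [dist_eq_norm] at h1
    calc _ ≤ L * ‖v - u‖ := h u (hQ1 a hu) v (hQ1 a hv)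
      _ ≤ L * (2 * ε / N) := by gcongr
      _ = L * (2 * ε) / N := by ring
      _ ≤ _ := by gcongr; linarith [pow_pos (two_pos (α := ℝ)) m]
  · rintro _ ⟨u, hu, rfl⟩
    obtain ⟨a, ha⟩ := mem_iUnion.1 (hQ3 hu)
    exact mem_iUnion.2 ⟨a, u, ha, rfl⟩

lemma cov_general {n m : ℕ} (φ : (Fin m → ℝ) → Heis n) (w0 : Fin m → ℝ) (ε K : ℝ)
    (hε : 0 < ε) (hK : 0 < K)
    (hL : ∀ u ∈ Metric.closedBall w0 ε, ∀ v ∈ Metric.closedBall w0 ε,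
      ‖φ v - φ u‖ ≤ K * ‖v - u‖) :
    ∃ C : ℝ, 0 < C ∧ ∀ N : ℕ, 1 ≤ N → ∃ (ι : Type) (_ : Fintype ι) (t : ι → Set (HK n)),
      (Fintype.card ι : ℝ) ≤ C * N ^ (m + 1) ∧ (∀ i, ∀ x ∈ t i, ∀ y ∈ t i, dist x y ≤ C / N) ∧
      φ '' Metric.closedBall w0 ε ⊆ ⋃ i, t i := by
  set D := K * (2 * ε) with hD
  have hD0 : 0 < D := by positivity
  -- a bound for `vert` on the compact piece
  obtain ⟨M, hM0, hM⟩ : ∃ M : ℝ, 0 < M ∧ ∀ u ∈ Metric.closedBall w0 ε, ∀ v : Heis n,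
      |vert (φ u) v| ≤ M * ‖v‖ := by
    refine ⟨‖vertL (φ w0)‖ + 2 * (K * ε) + 1, by positivity, fun u hu v => ?_⟩
    have h1 := abs_vert_change (φ w0) (φ u) v
    have h2 : |vert (φ w0) v| ≤ ‖vertL (φ w0)‖ * ‖v‖ := (vertL (φ w0)).le_opNorm v
    have h3 : ‖φ u - φ w0‖ ≤ K * ε := by
      refine (hL w0 (Metric.mem_closedBall_self hε.le) u hu).trans ?_
      gcongr
      rw [← dist_eq_norm]; exact hu
    have h4 : 2 * (‖φ u - φ w0‖ * ‖v‖) ≤ 2 * ((K * ε) * ‖v‖) := by gcongr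
    have h5 := abs_sub_abs_le_abs_sub (vert (φ u) v) (vert (φ w0) v)
    nlinarith [norm_nonneg v]
  set P := M * D with hP
  have hP0 : 0 < P := by positivity
  refine ⟨2 ^ m * (2 * P + 1) + 2 * (1 + 2 * D), by positivity, fun N hN => ?_⟩
  have hN0 : (1 : ℝ) ≤ N := by exact_mod_cast hN
  have hN1 : (0 : ℝ) < N := by linarith
  obtain ⟨Q, hQ1, hQ2, hQ3⟩ := cube_cover w0 hε N hN
  have hdist : ∀ a, ∀ u ∈ Q a, ∀ v ∈ Q a, ‖φ v - φ u‖ ≤ D / N := by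
    intro a u hu v hv
    have h1 := hQ2 a v hv u hu
    rw [dist_eq_norm] at h1
    calc _ ≤ K * ‖v - u‖ := hL u (hQ1 a hu) v (hQ1 a hv)
      _ ≤ K * (2 * ε / N) := by gcongr
      _ = _ := by rw [hD]; ring
  have hc : ∀ a, ∃ c, (Q a).Nonempty → c ∈ Q a := by
    intro a
    by_cases h : (Q a).Nonempty
    · exact ⟨h.some, fun _ => h.some_mem⟩
    · exact ⟨w0, fun h' => absurd h' h⟩
  choose c hc using hc
  set τ : (Fin m → Fin (N + 1)) → (Fin m → ℝ) → ℝ := fun a u => vert (φ (c a)) (φ u - φ (c a)) with hτ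
  have hτb : ∀ a, ∀ u ∈ Q a, |τ a u| ≤ P / N := by
    intro a u hu
    have hca := hc a ⟨u, hu⟩
    calc _ ≤ M * ‖φ u - φ (c a)‖ := hM _ (hQ1 a hca) _
      _ ≤ M * (D / N) := by gcongr; exact hdist a _ hca u hu
      _ = _ := by rw [hP]; ring
  set J := ⌊2 * P * N⌋₊ + 1 with hJ
  refine ⟨(Fin m → Fin (N + 1)) × Fin J, inferInstance,
    fun i => φ '' {u ∈ Q i.1 | ⌊(τ i.1 u + P / N) * N ^ 2⌋₊ = i.2}, ?_, ?_, ?_⟩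
  · simp only [Fintype.card_prod, Fintype.card_pi, Fintype.card_fin, Finset.prod_const,
      Finset.card_univ]
    push_cast
    have hJ1 : (J : ℝ) ≤ (2 * P + 1) * N := by
      rw [hJ]; push_cast
      have := Nat.floor_le (show 0 ≤ 2 * P * N by positivity)
      nlinarith
    calc ((N : ℝ) + 1) ^ m * J ≤ (2 * N) ^ m * ((2 * P + 1) * N) := by gcongr; linarith
      _ = 2 ^ m * (2 * P + 1) * N ^ (m + 1) := by rw [mul_pow]; ring
      _ ≤ _ := by gcongr; linarith
  · rintro ⟨a, j⟩ _ ⟨u, ⟨hu, huj⟩, rfl⟩ _ ⟨v, ⟨hv, hvj⟩, rfl⟩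
    show dH (φ u) (φ v) ≤ _
    simp only at hu hv huj hvj
    have hca := hc a ⟨u, hu⟩
    have hpos : ∀ w ∈ Q a, 0 ≤ (τ a w + P / N) * N ^ 2 := fun w hw => by
      have := (abs_le.1 (hτb a w hw)).1
      exact mul_nonneg (by linarith) (by positivity)
    have h1 := Nat.floor_le (hpos u hu)
    have h2 := Nat.floor_le (hpos v hv)
    have h3 := Nat.lt_floor_add_one ((τ a u + P / N) * N ^ 2)
    have h4 := Nat.lt_floor_add_one ((τ a v + P / N) * N ^ 2)
    rw [huj] at h1 h3
    rw [hvj] at h2 h4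
    have h5 : |(τ a v - τ a u) * N ^ 2| ≤ 1 := by
      rw [abs_le]; constructor <;> nlinarith
    have h6 : |τ a v - τ a u| ≤ 1 / N ^ 2 := by
      rw [abs_mul, abs_of_nonneg (by positivity : (0 : ℝ) ≤ (N : ℝ) ^ 2)] at h5
      rwa [le_div_iff₀ (by positivity)]
    have h7 : vert (φ u) (φ v - φ u) = (τ a v - τ a u)
        + (vert (φ u) (φ v - φ u) - vert (φ (c a)) (φ v - φ u)) := by
      simp only [hτ, vert_sub]; ring
    have h8 : |vert (φ u) (φ v - φ u)| ≤ ((1 + 2 * D) / N) ^ 2 := by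
      rw [h7]
      refine (abs_add_le _ _).trans ?_
      have h9 := abs_vert_change (φ (c a)) (φ u) (φ v - φ u)
      have h10 : 2 * (‖φ u - φ (c a)‖ * ‖φ v - φ u‖) ≤ 2 * (D / N * (D / N)) := by
        gcongr
        · exact hdist a _ hca u hu
        · exact hdist a _ hu v hv
      have h11 : ((1 + 2 * D) / N) ^ 2 = 1 / N ^ 2 + 2 * (D / N * (D / N)) + (4 * D + 2 * D ^ 2) / N ^ 2 := by
        field_simp; ring
      have h12 : 0 ≤ (4 * D + 2 * D ^ 2) / (N : ℝ) ^ 2 := by positivity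
      linarith
    have h13 : ‖(φ v).1 - (φ u).1‖ ≤ (1 + 2 * D) / N := by
      refine (norm_fst_le (φ v - φ u)).trans ((hdist a u hu v hv).trans ?_)
      gcongr; linarith
    refine (dH_le_of (by positivity) h13 h8).trans ?_
    rw [← mul_div_assoc]
    gcongr
    have : 0 < 2 ^ m * (2 * P + 1) := by positivity
    linarith
  · rintro _ ⟨u, hu, rfl⟩
    obtain ⟨a, ha⟩ := mem_iUnion.1 (hQ3 hu)
    have h1 := abs_le.1 (hτb a u ha)
    have h2 : ⌊(τ a u + P / N) * N ^ 2⌋₊ < J := by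
      rw [hJ, Nat.lt_succ_iff]
      apply Nat.floor_le_floor
      calc (τ a u + P / N) * N ^ 2 ≤ (2 * (P / N)) * N ^ 2 := by gcongr; linarith
        _ = _ := by field_simp
    exact mem_iUnion.2 ⟨(a, ⟨_, h2⟩), u, ⟨ha, rfl⟩, rfl⟩



lemma volume_le_of_expand {m : ℕ} (T : Set (Fin m → ℝ)) (f : (Fin m → ℝ) → (Fin m → ℝ)) (κ : ℝ)
    (hκ : 0 < κ) (h : ∀ u ∈ T, ∀ v ∈ T, κ * ‖u - v‖ ≤ ‖f u - f v‖) :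
    volume T ≤ ENNReal.ofReal (κ⁻¹) ^ m * volume (f '' T) := by
  have hinj : InjOn f T := by
    intro u hu v hv huv
    have h1 := h u hu v hv
    rw [huv, sub_self, norm_zero] at h1
    have h2 : ‖u - v‖ ≤ 0 := by
      by_contra h3
      have := mul_pos hκ (not_le.1 h3)
      linarith
    exact sub_eq_zero.1 (norm_le_zero_iff.1 h2)
  have hg : ∀ u ∈ T, Function.invFunOn f T (f u) = u := fun u hu => hinj.leftInvOn_invFunOn hu
  have hlip : LipschitzOnWith (κ⁻¹).toNNReal (Function.invFunOn f T) (f '' T) := by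
    apply LipschitzOnWith.of_dist_le_mul
    rintro _ ⟨u, hu, rfl⟩ _ ⟨v, hv, rfl⟩
    rw [hg u hu, hg v hv, Real.coe_toNNReal _ (by positivity), dist_eq_norm, dist_eq_norm,
      inv_mul_eq_div, le_div_iff₀ hκ, mul_comm]
    exact h u hu v hv
  have him : Function.invFunOn f T '' (f '' T) = T := by
    rw [image_image]
    exact (image_congr hg).trans (image_id' T)
  have := hlip.hausdorffMeasure_image_le (d := (m : ℝ)) (by positivity)
  rw [him] at this
  have hv : (μH[(m : ℝ)] : Measure (Fin m → ℝ)) = volume := by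
    simpa using hausdorffMeasure_pi_real (ι := Fin m)
  rw [hv, ENNReal.rpow_natCast] at this
  exact this

lemma exists_linear {n m : ℕ} (p : Heis n) (A : (Fin m → ℝ) →L[ℝ] Heis n)
    (hA : Function.Injective A) (v : Fin m → ℝ) (hv : vert p (A v) ≠ 0) :
    ∃ (i : Fin m) (Λ : (ℝ × EuclideanSpace ℝ (Fin (2 * n))) →L[ℝ] (Fin m → ℝ)) (κ : ℝ), 0 < κ ∧
      (∀ t z, Λ (t, z) i = t) ∧ ∀ w, κ * ‖w‖ ≤ ‖Λ (vert p (A w), (A w).1)‖ := by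
  set l : (Fin m → ℝ) →ₗ[ℝ] ℝ := ((vertL p).comp A).toLinearMap with hl
  have hl' : ∀ w, l w = vert p (A w) := fun w => rfl
  set M : (Fin m → ℝ) →ₗ[ℝ] ℝ × EuclideanSpace ℝ (Fin (2 * n)) :=
    l.prod ((LinearMap.fst ℝ _ ℝ).comp A.toLinearMap) with hM
  have hM' : ∀ w, M w = (vert p (A w), (A w).1) := fun w => rfl
  have hMi : LinearMap.ker M = ⊥ := by
    rw [LinearMap.ker_eq_bot']
    intro w hw
    rw [hM', Prod.mk_eq_zero] at hw
    obtain ⟨h1, h2⟩ := hw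
    apply hA
    rw [map_zero]
    refine Prod.ext h2 ?_
    rw [vert, h2] at h1
    have : symp p.1 (0 : EuclideanSpace ℝ (Fin (2 * n))) = 0 := by simp [symp]
    rw [this, sub_zero] at h1
    exact h1
  obtain ⟨Λ0, hΛ0⟩ := M.exists_leftInverse_of_injective hMi
  have hΛ0' : ∀ w, Λ0 (M w) = w := fun w => LinearMap.congr_fun hΛ0 w
  obtain ⟨i, hi⟩ : ∃ i, l (Pi.single i 1) ≠ 0 := by
    by_contra! hcon
    apply hv
    rw [← hl']
    have : l = 0 := by
      apply LinearMap.pi_ext'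
      intro i
      ext
      simpa using hcon i
    rw [this]; rfl
  set Λ1 : (ℝ × EuclideanSpace ℝ (Fin (2 * n))) →ₗ[ℝ] (Fin m → ℝ) :=
    Λ0 + (LinearMap.toSpanSingleton ℝ (Fin m → ℝ) (Pi.single i 1)).comp
      (LinearMap.fst ℝ _ _ - (LinearMap.proj i).comp Λ0) with hΛ1
  have hΛ1' : ∀ y, Λ1 y = Λ0 y + (y.1 - Λ0 y i) • Pi.single i (1 : ℝ) := fun y => rfl
  have hker : LinearMap.ker (Λ1.comp M) = ⊥ := by
    rw [LinearMap.ker_eq_bot']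
    intro w hw
    rw [LinearMap.comp_apply, hΛ1', hΛ0'] at hw
    have hw1 : (M w).1 = l w := rfl
    rw [hw1] at hw
    have h1 : l w = 0 := by
      have := congrFun hw i
      simpa using this
    have h2 : w = (w i) • Pi.single i (1 : ℝ) := by
      rw [h1, zero_sub, neg_smul] at hw
      exact eq_of_sub_eq_zero (by rw [sub_eq_add_neg]; exact hw)
    have h3 : w i * l (Pi.single i 1) = 0 := by
      rw [← smul_eq_mul, ← map_smul, ← h2, h1]
    have h4 : w i = 0 := (mul_eq_zero.1 h3).resolve_right hi
    rw [h2, h4, zero_smul]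
  obtain ⟨k, hk, hanti⟩ := (Λ1.comp M).exists_antilipschitzWith hker
  refine ⟨i, LinearMap.toContinuousLinearMap Λ1, (k : ℝ)⁻¹, by positivity, ?_, ?_⟩
  · intro t z
    show Λ1 (t, z) i = t
    rw [hΛ1']; simp
  · intro w
    have h1 := hanti.le_mul_dist w 0
    rw [dist_zero_right, map_zero, dist_zero_right] at h1
    rw [inv_mul_eq_div, div_le_iff₀ (by positivity), mul_comm]
    exact h1

lemma exists_expand {n m : ℕ} (φ : (Fin m → ℝ) → Heis n) (w0 : Fin m → ℝ) (ε K : ℝ) (hε : 0 < ε)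
    (hK : 0 < K) (A : (Fin m → ℝ) →L[ℝ] Heis n) (hA : HasStrictFDerivAt φ A w0)
    (hL : ∀ u ∈ Metric.closedBall w0 ε, ∀ v ∈ Metric.closedBall w0 ε,
      ‖φ v - φ u‖ ≤ K * ‖v - u‖)
    (Λ : (ℝ × EuclideanSpace ℝ (Fin (2 * n))) →L[ℝ] (Fin m → ℝ)) (κ : ℝ) (hκ : 0 < κ)
    (hΛ : ∀ w, κ * ‖w‖ ≤ ‖Λ (vert (φ w0) (A w), (A w).1)‖) :
    ∃ δ : ℝ, 0 < δ ∧ δ ≤ ε ∧ ∀ q ∈ Metric.ball w0 δ, ∀ u ∈ Metric.ball w0 δ,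
      ∀ v ∈ Metric.ball w0 δ,
      κ / 2 * ‖u - v‖ ≤ ‖Λ (vert (φ q) (φ u - φ v), (φ u - φ v).1)‖ := by
  set p := φ w0 with hp
  set a := ‖Λ‖ * (‖vertL p‖ + 1) + 1 with ha
  have ha0 : 0 < a := by positivity
  set b := ‖Λ‖ * (2 * K * K) + 1 with hb
  have hb0 : 0 < b := by positivity
  have h1 := hA.isLittleO.def (show 0 < κ / (4 * a) by positivity)
  obtain ⟨δ1, hδ1, h2⟩ := Metric.nhds_basis_ball.eventually_iff.1 h1
  refine ⟨min (min δ1 ε) (κ / (4 * b)), by positivity,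
    (min_le_left _ _).trans (min_le_right _ _), ?_⟩
  intro q hq u hu v hv
  rw [Metric.mem_ball, lt_min_iff, lt_min_iff] at hq hu hv
  have h3 : (u, v) ∈ Metric.ball (w0, w0) δ1 := by
    rw [Metric.mem_ball, Prod.dist_eq, max_lt_iff]; exact ⟨hu.1.1, hv.1.1⟩
  have h4 := h2 h3
  simp only at h4
  set d := φ u - φ v with hd
  set w := u - v with hw
  have h5 : ‖d‖ ≤ K * ‖w‖ := hL v hv.1.2.le u hu.1.2.le
  have h6 : ‖φ q - p‖ ≤ K * (κ / (4 * b)) := by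
    refine (hL w0 (Metric.mem_closedBall_self hε.le) q hq.1.2.le).trans ?_
    rw [← dist_eq_norm]
    gcongr
    exact hq.2.le
  have h7 : Λ (vert (φ q) d, d.1) = Λ (vert p (A w), (A w).1)
      + Λ (vert p (d - A w), (d - A w).1) + Λ (vert (φ q) d - vert p d, 0) := by
    rw [← map_add, ← map_add]
    congr 1
    refine Prod.ext ?_ ?_
    · simp only [Prod.fst_add, vert_sub]; ring
    · simp
  have h8 : ‖Λ (vert p (d - A w), (d - A w).1)‖ ≤ κ / 4 * ‖w‖ := by
    have h9 : ‖((vert p (d - A w), (d - A w).1) : ℝ × EuclideanSpace ℝ (Fin (2 * n)))‖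
        ≤ (‖vertL p‖ + 1) * ‖d - A w‖ := by
      rw [Prod.norm_def, max_le_iff]
      constructor
      · refine ((vertL p).le_opNorm _).trans ?_
        gcongr; linarith
      · refine (norm_fst_le (d - A w)).trans ?_
        exact le_mul_of_one_le_left (norm_nonneg _) (by linarith [norm_nonneg (vertL p)])
    calc _ ≤ ‖Λ‖ * ((‖vertL p‖ + 1) * (κ / (4 * a) * ‖w‖)) := by
          refine (Λ.le_opNorm _).trans ?_
          gcongr
          refine h9.trans ?_
          gcongr
      _ = (‖Λ‖ * (‖vertL p‖ + 1)) * (κ / (4 * a) * ‖w‖) := by ring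
      _ ≤ a * (κ / (4 * a) * ‖w‖) := by gcongr; rw [ha]; linarith
      _ = _ := by field_simp
  have h10 : ‖Λ (vert (φ q) d - vert p d, 0)‖ ≤ κ / 4 * ‖w‖ := by
    have h11 : ‖((vert (φ q) d - vert p d, 0) : ℝ × EuclideanSpace ℝ (Fin (2 * n)))‖
        ≤ 2 * (‖φ q - p‖ * ‖d‖) := by
      rw [Prod.norm_def, max_le_iff]
      refine ⟨abs_vert_change p (φ q) d, ?_⟩
      simp only [norm_zero]; positivity
    calc _ ≤ ‖Λ‖ * (2 * ((K * (κ / (4 * b))) * (K * ‖w‖))) := by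
          refine (Λ.le_opNorm _).trans ?_
          gcongr
          refine h11.trans ?_
          gcongr
      _ = (‖Λ‖ * (2 * K * K)) * (κ / (4 * b) * ‖w‖) := by ring
      _ ≤ b * (κ / (4 * b) * ‖w‖) := by gcongr; rw [hb]; linarith
      _ = _ := by field_simp
  have h12 := hΛ w
  rw [h7]
  have h13 := norm_sub_le_norm_add (Λ (vert p (A w), (A w).1) + Λ (vert p (d - A w), (d - A w).1))
    (Λ (vert (φ q) d - vert p d, 0))
  have h14 := norm_sub_le_norm_add (Λ (vert p (A w), (A w).1)) (Λ (vert p (d - A w), (d - A w).1))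
  linarith



lemma lower_vertical {n m : ℕ} (φ : (Fin m → ℝ) → Heis n) (w0 : Fin m → ℝ) (ε K : ℝ) (hε : 0 < ε)
    (hK : 0 < K) (A : (Fin m → ℝ) →L[ℝ] Heis n) (hA : HasStrictFDerivAt φ A w0)
    (hAi : Function.Injective A)
    (hL : ∀ u ∈ Metric.closedBall w0 ε, ∀ v ∈ Metric.closedBall w0 ε,
      ‖φ v - φ u‖ ≤ K * ‖v - u‖) (v : Fin m → ℝ) (hv : vert (φ w0) (A v) ≠ 0)
    (S : Set (HK n)) (hS : ∀ u ∈ Metric.closedBall w0 ε, φ u ∈ S) :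
    ((m + 1 : ℕ) : ℝ≥0∞) ≤ dimH S := by
  obtain ⟨i, Λ, κ, hκ, hΛi, hΛ⟩ := exists_linear (φ w0) A hAi v hv
  obtain ⟨δ, hδ, hδε, hexp⟩ := exists_expand φ w0 ε K hε hK A hA hL Λ κ hκ hΛ
  have hsub : Metric.ball w0 δ ⊆ Metric.closedBall w0 ε :=
    Metric.ball_subset_closedBall.trans (Metric.closedBall_subset_closedBall hδε)
  set c := ‖Λ‖ + 1 with hc
  have hc0 : 0 < c := by positivity
  have hcont : ContinuousOn φ (Metric.ball w0 δ) := by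
    have : LipschitzOnWith K.toNNReal φ (Metric.ball w0 δ) := by
      apply LipschitzOnWith.of_dist_le_mul
      intro a ha b hb
      rw [Real.coe_toNNReal _ hK.le, dist_eq_norm, dist_eq_norm]
      exact hL b (hsub hb) a (hsub ha)
    exact this.continuousOn
  refine le_dimH_of_mass (X := HK n) volume (Metric.ball w0 δ) measurableSet_ball
    (Metric.measure_ball_pos volume w0 hδ).ne' φ hcont S ?_ (m + 1) (Nat.succ_pos m)
    ((κ / 2)⁻¹ ^ m * (2 * (2 * c) ^ (m - 1))) (by positivity) ?_
  · rintro _ ⟨u, hu, rfl⟩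
    exact hS u (hsub hu)
  intro q hq r hr0 hr1
  set T := {u ∈ Metric.ball w0 δ | dist (α := HK n) (φ q) (φ u) ≤ r} with hT
  set f : (Fin m → ℝ) → (Fin m → ℝ) := fun u =>
    Λ (vert (φ q) (φ u - φ q), (φ u - φ q).1) with hf
  have h1 := volume_le_of_expand T f (κ / 2) (by positivity) (by
    intro u hu v hv
    refine (hexp q hq u hu.1 v hv.1).trans (le_of_eq ?_)
    rw [hf]
    simp only
    rw [← map_sub]
    congr 2
    refine Prod.ext ?_ ?_
    · simp only [Prod.fst_sub, vert_sub]; ring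
    · simp)
  set b : Fin m → ℝ := fun j => if j = i then r ^ 2 else c * r with hb
  have h2 : f '' T ⊆ Set.pi univ (fun j => Icc (- b j) (b j)) := by
    rintro _ ⟨u, ⟨hu, hur⟩, rfl⟩ j -
    have hur' : dH (φ q) (φ u) ≤ r := hur
    have h3 : |vert (φ q) (φ u - φ q)| ≤ r ^ 2 :=
      (vert_le_dH _ _).trans (pow_le_pow_left₀ (dH_nonneg _ _) hur' 2)
    have h4 : ‖(φ u - φ q).1‖ ≤ r := (norm_le_dH (φ q) (φ u)).trans hur'
    rw [mem_Icc, ← abs_le]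
    by_cases hj : j = i
    · subst hj
      simp only [hb, hf, if_true, hΛi]
      exact h3
    · simp only [hb, if_neg hj]
      refine (norm_le_pi_norm (f u) j).trans ((Λ.le_opNorm _).trans ?_)
      have h5 : ‖((vert (φ q) (φ u - φ q), (φ u - φ q).1) :
          ℝ × EuclideanSpace ℝ (Fin (2 * n)))‖ ≤ r := by
        rw [Prod.norm_def, max_le_iff]
        refine ⟨h3.trans ?_, h4⟩
        nlinarith
      calc _ ≤ ‖Λ‖ * r := by gcongr
        _ ≤ c * r := by gcongr; rw [hc]; linarith
  have h6 : volume (Set.pi univ (fun j => Icc (- b j) (b j))) =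
      ENNReal.ofReal (2 * (2 * c) ^ (m - 1) * r ^ (m + 1)) := by
    rw [volume_pi_pi]
    simp only [Real.volume_Icc]
    have hb0 : ∀ j, 0 ≤ b j := by
      intro j; simp only [hb]; split_ifs <;> positivity
    rw [← ENNReal.ofReal_prod_of_nonneg (fun j _ => by linarith [hb0 j])]
    congr 1
    rw [← Finset.mul_prod_erase Finset.univ _ (Finset.mem_univ i)]
    have h7 : ∏ j ∈ Finset.univ.erase i, (b j - - b j) = (2 * c * r) ^ (m - 1) := by
      rw [Finset.prod_congr rfl (g := fun _ => 2 * c * r)]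
      · rw [Finset.prod_const, Finset.card_erase_of_mem (Finset.mem_univ i)]; simp
      · intro j hj
        simp only [hb, if_neg (Finset.ne_of_mem_erase hj)]; ring
    rw [h7]
    simp only [hb, if_true]
    obtain ⟨m', hm'⟩ : ∃ m', m = m' + 1 := ⟨m - 1, by have := i.isLt; omega⟩
    rw [show m - 1 = m' by omega, show m + 1 = m' + 2 by omega]
    ring
  calc volume T ≤ ENNReal.ofReal ((κ / 2)⁻¹) ^ m * volume (f '' T) := h1
    _ ≤ ENNReal.ofReal ((κ / 2)⁻¹) ^ m * ENNReal.ofReal (2 * (2 * c) ^ (m - 1) * r ^ (m + 1)) := by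
        rw [← h6]; gcongr
    _ = _ := by
        rw [← ENNReal.ofReal_pow (by positivity), ← ENNReal.ofReal_mul (by positivity)]
        congr 1; ring

lemma lower_horizontal {n m : ℕ} (φ : (Fin m → ℝ) → Heis n) (w0 : Fin m → ℝ) (ε L : ℝ)
    (hε : 0 < ε) (hL : 0 < L) (π : Heis n →L[ℝ] (Fin m → ℝ))
    (hπ : ∀ w ∈ Metric.closedBall w0 ε, π (φ w) = w)
    (h : ∀ u ∈ Metric.closedBall w0 ε, ∀ v ∈ Metric.closedBall w0 ε,
      dH (φ u) (φ v) ≤ L * ‖v - u‖)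
    (S : Set (HK n)) (hS : ∀ u ∈ Metric.closedBall w0 ε, φ u ∈ S) :
    (m : ℝ≥0∞) ≤ dimH S := by
  have hbd : ∀ u ∈ Metric.closedBall w0 ε, ‖(φ u).1‖ ≤ ‖(φ w0).1‖ + L * ε := by
    intro u hu
    have h1 := h w0 (Metric.mem_closedBall_self hε.le) u hu
    have h2 := norm_le_dH (φ w0) (φ u)
    have h3 : ‖u - w0‖ ≤ ε := by rw [← dist_eq_norm]; exact hu
    have h4 := norm_sub_norm_le (φ u).1 (φ w0).1
    have h5 : L * ‖u - w0‖ ≤ L * ε := by gcongr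
    linarith
  set D := ‖π‖ * (1 + 2 * (‖(φ w0).1‖ + L * ε) + L * (2 * ε)) with hD
  have hD0 : 0 ≤ D := by positivity
  let g : HK n → (Fin m → ℝ) := fun x => π x
  let T : Set (HK n) := φ '' Metric.closedBall w0 ε
  have hlip : LipschitzOnWith D.toNNReal g T := by
    apply LipschitzOnWith.of_dist_le_mul
    rintro _ ⟨u, hu, rfl⟩ _ ⟨v, hv, rfl⟩
    rw [Real.coe_toNNReal _ hD0]
    show dist (π (φ u)) (π (φ v)) ≤ D * dH (φ u) (φ v)
    rw [dist_comm, dist_eq_norm, ← map_sub]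
    have h1 := norm_sub_le_dH (φ u) (φ v)
    have h2 : ‖v - u‖ ≤ 2 * ε := by
      rw [← dist_eq_norm]
      refine (dist_triangle_right v u w0).trans ?_
      have h3 : dist v w0 ≤ ε := hv
      have h4 : dist u w0 ≤ ε := hu
      linarith
    have h5 : dH (φ u) (φ v) ≤ L * (2 * ε) := (h u hu v hv).trans (by gcongr)
    calc _ ≤ ‖π‖ * ((1 + 2 * ‖(φ u).1‖ + dH (φ u) (φ v)) * dH (φ u) (φ v)) :=
          (π.le_opNorm _).trans (by gcongr)
      _ ≤ ‖π‖ * ((1 + 2 * (‖(φ w0).1‖ + L * ε) + L * (2 * ε)) * dH (φ u) (φ v)) := by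
          have := dH_nonneg (φ u) (φ v)
          gcongr
          exact hbd u hu
      _ = _ := by rw [hD]; ring
  have h6 := hlip.dimH_image_le
  have h7 : g '' T = Metric.closedBall w0 ε := by
    ext w; constructor
    · rintro ⟨_, ⟨u, hu, rfl⟩, rfl⟩
      show π (φ u) ∈ _
      rw [hπ u hu]; exact hu
    · intro hw
      exact ⟨φ w, ⟨w, hw, rfl⟩, hπ w hw⟩
  have h8 : dimH (Metric.closedBall w0 ε) = (m : ℝ≥0∞) := by
    rw [Real.dimH_of_mem_nhds (Metric.closedBall_mem_nhds w0 hε)]; simp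
  rw [h7, h8] at h6
  refine h6.trans (dimH_mono ?_)
  rintro _ ⟨u, hu, rfl⟩
  exact hS u hu

theorem dim_part (n : ℕ) (μ : Measure (Heis n)) [μ.Regular] (hμ : μ ≠ 0)
    (hud : UniformlyDistributed μ) : ∃ k : ℕ, dimHH (suppH μ) = k := by
  obtain ⟨F, hF, hS⟩ := analytic_part n μ hμ hud
  obtain ⟨m, B, U, φ, π, hB, ⟨wB, hwB⟩, hU, hφ, hπ, hSU⟩ := exists_chart (suppH μ)
    (nonempty_suppH μ hμ) {f | ∃ s > 0, f = F s}
    (by rintro _ ⟨s, hs, rfl⟩ x; exact hF s hs x)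
    (by
      rw [hS]; ext x
      simp only [mem_iInter, mem_setOf_eq]
      constructor
      · rintro h _ ⟨s, hs, rfl⟩; exact h s hs
      · intro h s hs; exact h _ ⟨s, hs, rfl⟩)
  have hφS : ∀ w ∈ B, φ w ∈ suppH μ := fun w hw => by
    have : φ w ∈ suppH μ ∩ U := hSU ▸ ⟨w, hw, rfl⟩
    exact this.1
  -- the upper bound from covers
  have hupper : ∀ w0 ∈ B, ∀ ε : ℝ, 0 < ε → ∀ k : ℕ,
      (∃ C : ℝ, 0 < C ∧ ∀ N : ℕ, 1 ≤ N → ∃ (ι : Type) (_ : Fintype ι) (t : ι → Set (HK n)),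
        (Fintype.card ι : ℝ) ≤ C * N ^ k ∧ (∀ i, ∀ x ∈ t i, ∀ y ∈ t i, dist x y ≤ C / N) ∧
        φ '' Metric.closedBall w0 ε ⊆ ⋃ i, t i) → dimH (X := HK n) (suppH μ) ≤ k := by
    intro w0 hw0 ε hε k ⟨C, hC, hcov⟩
    obtain ⟨ρ, hρ, hloc⟩ := exists_localize (suppH μ) B U hU φ π hπ hSU w0 hw0 ε hε
    let ν : Measure (HK n) := μ
    have : IsFiniteMeasureOnCompacts ν :=
      ⟨fun K hK => IsCompact.measure_lt_top (α := Heis n) (μ := μ) hK⟩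
    refine dimH_le_of_uniform (X := HK n) ν (suppH μ) (isClosed_suppH μ) (measure_compl_suppH μ)
      ?_ ?_ (φ w0) (hφS w0 hw0) ρ hρ k C hC ?_
    · intro x hx r hr
      rw [closedBall_HK]; exact hx r hr
    · intro x hx y hy r hr
      rw [closedBall_HK, closedBall_HK]; exact hud x hx y hy r hr
    · intro N hN
      obtain ⟨ι, hι, t, h1, h2, h3⟩ := hcov N hN
      refine ⟨ι, hι, t, h1, h2, ?_⟩
      intro x hx
      exact h3 (hloc ⟨hx.1, (closedBall_HK (n := n) (φ w0) ρ).subset hx.2⟩)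
  by_cases hver : ∃ w0 ∈ B, ∃ v, vert (φ w0) (fderiv ℝ φ w0 v) ≠ 0
  · obtain ⟨w0, hw0, v, hv⟩ := hver
    obtain ⟨ε, K, hε, hK, hsub, hd, hdK, hL⟩ := exists_local B hB φ hφ w0 hw0
    refine ⟨m + 1, (dimHH_eq (n := n) (suppH μ)).trans (le_antisymm ?_ ?_)⟩
    · exact hupper w0 hw0 ε hε (m + 1) (cov_general φ w0 ε K hε hK hL)
    · have hst : HasStrictFDerivAt φ (fderiv ℝ φ w0) w0 :=
        (hφ w0 hw0).hasStrictFDerivAt (by simp)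
      refine lower_vertical φ w0 ε K hε hK (fderiv ℝ φ w0) hst ?_ hL v hv (suppH μ)
        (fun u hu => hφS u (hsub hu))
      have h1 : HasFDerivAt (fun w => π (φ w)) (π.comp (fderiv ℝ φ w0)) w0 :=
        π.hasFDerivAt.comp w0 hst.hasFDerivAt
      have h2 : HasFDerivAt (fun w => π (φ w)) (ContinuousLinearMap.id ℝ (Fin m → ℝ)) w0 := by
        refine (hasFDerivAt_id w0).congr_of_eventuallyEq ?_
        filter_upwards [hB.mem_nhds hw0] with w hw
        exact hπ w hw
      have h3 := h1.unique h2
      intro x y hxy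
      have h4 := congrArg π hxy
      have h5 : ∀ z, π (fderiv ℝ φ w0 z) = z := fun z => by
        have := DFunLike.congr_fun h3 z
        simpa using this
      rwa [h5, h5] at h4
  · push Not at hver
    obtain ⟨ε, K, hε, hK, hsub, hd, hdK, hL⟩ := exists_local B hB φ hφ wB hwB
    have hH := horizontal_bound φ wB ε K hK hd hdK hL (fun w hw => hver w (hsub hw))
    have hH' : ∀ u ∈ Metric.closedBall wB ε, ∀ v ∈ Metric.closedBall wB ε,
      dH (φ u) (φ v) ≤ (4 * K) * ‖v - u‖ := fun u hu v hv => hH u v hu hv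
    refine ⟨m, (dimHH_eq (n := n) (suppH μ)).trans (le_antisymm ?_ ?_)⟩
    · exact hupper wB hwB ε hε m (cov_horizontal φ wB ε (4 * K) hε (by positivity) hH')
    · exact lower_horizontal φ wB ε (4 * K) hε (by positivity) π (fun w hw => hπ w (hsub hw)) hH'
        (suppH μ) (fun u hu => hφS u (hsub hu))


/-- The support of a nonzero uniformly distributed measure on `(ℍⁿ, d_H)` is a real analytic
variety in `ℝ^{2n+1}`: it is the common zero set of a family `(F_s)_{s>0}` of real analytic
functions. Moreover its Hausdorff dimension with respect to `d_H` is an integer. -/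
theorem statement7 (n : ℕ) (μ : Measure (Heis n)) [μ.Regular] (hμ : μ ≠ 0)
    (hud : UniformlyDistributed μ) :
    (∃ F : ℝ → Heis n → ℝ, (∀ s : ℝ, 0 < s → ∀ x : Heis n, AnalyticAt ℝ (F s) x) ∧
      suppH μ = ⋂ (s : ℝ) (_ : 0 < s), {x : Heis n | F s x = 0}) ∧
    (∃ k : ℕ, dimHH (suppH μ) = k) := by 
  exact ⟨analytic_part n μ hμ hud, dim_part n μ hμ hud⟩
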